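/- arXiv:1505.00955 — 8 statements merged into one kernel-verified Lean document; each statement's English description precedes it below -/
import Mathlib

section
/- Let (g,n) be a pair of finite-dimensional complex Lie algebras defined on the same underlying vector space, where g is simple and n is arbitrary. If (g,n) admits a post-Lie algebra structure, then the Lie algebra n is isomorphic to g. -/
/-- A post-Lie algebra structure on the pair of Lie algebras `(G, N)` defined on the same
underlying vector space, the identification of the underlying spaces being the linear
equivalence `e`.  The product is the bilinear map `p`. -/
structure IsPostLieStruct {k G N : Type*} [CommRing k] [LieRing G] [LieAlgebra k G]
    [LieRing N] [LieAlgebra k N] (e : G ≃ₗ[k] N) (p : G →ₗ[k] G →ₗ[k] G) : Prop where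
  ax1 : ∀ x y : G, p x y - p y x = ⁅x, y⁆ - e.symm ⁅e x, e y⁆
  ax2 : ∀ x y z : G, p ⁅x, y⁆ z = p x (p y z) - p y (p x z)
  ax3 : ∀ x y z : G, p x (e.symm ⁅e y, e z⁆) = e.symm ⁅e (p x y), e z⁆ + e.symm ⁅e y, e (p x z)⁆

section PostLieHelpers
open Module

theorem plPerfect (G : Type*) [LieRing G] [LieAlgebra ℂ G] [LieAlgebra.IsSimple ℂ G] :
    ⁅(⊤ : LieIdeal ℂ G), (⊤ : LieIdeal ℂ G)⁆ = ⊤ := by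
  rcases LieAlgebra.IsSimple.eq_bot_or_eq_top (R := ℂ) ⁅(⊤ : LieIdeal ℂ G), (⊤ : LieIdeal ℂ G)⁆
    with h | h
  · exfalso
    apply LieAlgebra.IsSimple.non_abelian (R := ℂ) (L := G)
    constructor
    intro x y
    have : ⁅x, y⁆ ∈ ⁅(⊤ : LieIdeal ℂ G), (⊤ : LieIdeal ℂ G)⁆ :=
      LieSubmodule.lie_mem_lie (LieSubmodule.mem_top x) (LieSubmodule.mem_top y)
    rw [h] at this
    simpa using this
  · exact h

theorem plPerfectInd {G : Type*} [LieRing G] [LieAlgebra ℂ G] [LieAlgebra.IsSimple ℂ G]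
    (S : Submodule ℂ G) (h : ∀ x y : G, ⁅x, y⁆ ∈ S) (x : G) : x ∈ S := by
  have hx : x ∈ (⁅(⊤ : LieIdeal ℂ G), (⊤ : LieIdeal ℂ G)⁆ : LieIdeal ℂ G).toSubmodule := by
    rw [plPerfect]; trivial
  rw [LieSubmodule.lieIdeal_oper_eq_linear_span'] at hx
  refine Submodule.span_le.2 ?_ hx
  rintro _ ⟨a, -, b, -, rfl⟩
  exact h a b

/-- traces of a module of a simple Lie algebra vanish -/
theorem plTrace {G V : Type*} [LieRing G] [LieAlgebra ℂ G] [LieAlgebra.IsSimple ℂ G]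
    [AddCommGroup V] [Module ℂ V] [LieRingModule G V] [LieModule ℂ G V] (x : G) :
    LinearMap.trace ℂ V (LieModule.toEnd ℂ G V x) = 0 := by
  have := plPerfectInd (LinearMap.ker (LinearMap.trace ℂ V ∘ₗ (LieModule.toEnd ℂ G V : G →ₗ[ℂ] _)))
    (by intro x y; simp) x
  simpa using this

theorem plTrivial {G V : Type*} [LieRing G] [LieAlgebra ℂ G] [LieAlgebra.IsSimple ℂ G]
    [AddCommGroup V] [Module ℂ V] [LieRingModule G V] [LieModule ℂ G V] [FiniteDimensional ℂ V]
    (h : LieModule.traceForm ℂ G V = 0) (x : G) (v : V) : ⁅x, v⁆ = 0 := by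
  have h1 := LieModule.isNilpotent_derivedSeries_of_traceForm_eq_zero h
  have hD : ∀ x : G, x ∈ LieAlgebra.derivedSeries ℂ G 1 := by
    intro x
    change x ∈ ⁅(⊤ : LieIdeal ℂ G), (⊤ : LieIdeal ℂ G)⁆
    rw [plPerfect]; trivial
  have h2 : LieModule.IsNilpotent G V := by
    rw [LieModule.isNilpotent_iff_forall' (R := ℂ)] at h1 ⊢
    intro x
    exact h1 ⟨x, hD x⟩
  obtain ⟨k, hk⟩ := (LieModule.isNilpotent_iff ℂ G V).1 h2
  have key : ∀ k (x : G) (v : V), ⁅x, v⁆ ∈ LieModule.lowerCentralSeries ℂ G V k := by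
    intro k
    induction k with
    | zero => intro x v; simp
    | succ k ih =>
      intro x v
      let S : Submodule ℂ G := (LieModule.lowerCentralSeries ℂ G V (k+1)).toSubmodule.comap
        ((LieModule.toEnd ℂ G V : G →ₗ[ℂ] Module.End ℂ V).flip v)
      refine plPerfectInd S ?_ x
      intro a b
      change ⁅⁅a, b⁆, v⁆ ∈ LieModule.lowerCentralSeries ℂ G V (k+1)
      rw [lie_lie, LieModule.lowerCentralSeries_succ]
      exact sub_mem (LieSubmodule.lie_mem_lie (LieSubmodule.mem_top _) (ih _ _))
        (LieSubmodule.lie_mem_lie (LieSubmodule.mem_top _) (ih _ _))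
  have := key k x v
  rw [hk] at this
  simpa using this

theorem plNondeg {G V : Type*} [LieRing G] [LieAlgebra ℂ G] [LieAlgebra.IsSimple ℂ G]
    [FiniteDimensional ℂ G]
    [AddCommGroup V] [Module ℂ V] [LieRingModule G V] [LieModule ℂ G V] [FiniteDimensional ℂ V]
    (h : LieModule.traceForm ℂ G V ≠ 0) : (LieModule.traceForm ℂ G V).Nondegenerate := by
  let I : LieIdeal ℂ G :=
    { LinearMap.ker (LieModule.traceForm ℂ G V) with
      lie_mem := by
        intro x m hm
        have hm' : LieModule.traceForm ℂ G V m = 0 := hm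
        change LieModule.traceForm ℂ G V ⁅x, m⁆ = 0
        ext y
        rw [← lie_skew, map_neg, LinearMap.neg_apply, LieModule.traceForm_apply_lie_apply, hm']
        simp }
  have hI : I = ⊥ := by
    rcases LieAlgebra.IsSimple.eq_bot_or_eq_top (R := ℂ) I with h1 | h1
    · exact h1
    · exfalso; apply h
      ext x y
      have : x ∈ I := by rw [h1]; trivial
      have h2 : LieModule.traceForm ℂ G V x = 0 := this
      rw [h2]; rfl
  have hk : LinearMap.ker (LieModule.traceForm ℂ G V) = ⊥ := by
    have := congrArg LieSubmodule.toSubmodule hI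
    exact this
  rw [LinearMap.BilinForm.nondegenerate_iff_ker_eq_bot]
  exact hk

/-- invariance of dual bases -/
theorem plDual {G ι M : Type*} [LieRing G] [LieAlgebra ℂ G] [Fintype ι] [DecidableEq ι]
    [AddCommGroup M] [Module ℂ M] (B : LinearMap.BilinForm ℂ G) (b b' : ι → G)
    (h1 : ∀ x, x = ∑ j, B x (b' j) • b j) (h2 : ∀ x, x = ∑ j, B (b j) x • b' j)
    (hB : ∀ x y z : G, B ⁅x, y⁆ z = - B y ⁅x, z⁆)
    (T : G →ₗ[ℂ] G →ₗ[ℂ] M) (y : G) :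
    ∑ i, (T ⁅y, b i⁆ (b' i) + T (b i) ⁅y, b' i⁆) = 0 := by
  rw [Finset.sum_add_distrib]
  have e1 : ∑ i, T ⁅y, b i⁆ (b' i) = ∑ i, ∑ j, B ⁅y, b i⁆ (b' j) • T (b j) (b' i) := by
    refine Finset.sum_congr rfl fun i _ => ?_
    conv_lhs => rw [h1 ⁅y, b i⁆]
    simp
  have e2 : ∑ i, T (b i) ⁅y, b' i⁆ = ∑ i, ∑ j, B (b j) ⁅y, b' i⁆ • T (b i) (b' j) := by
    refine Finset.sum_congr rfl fun i _ => ?_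
    conv_lhs => rw [h2 ⁅y, b' i⁆]
    simp
  rw [e1, e2, Finset.sum_comm, ← Finset.sum_add_distrib]
  refine Finset.sum_eq_zero fun i _ => ?_
  rw [← Finset.sum_add_distrib]
  refine Finset.sum_eq_zero fun j _ => ?_
  rw [hB]
  simp

theorem plWhitehead {G : Type*} [LieRing G] [LieAlgebra ℂ G] [LieAlgebra.IsSimple ℂ G]
    [FiniteDimensional ℂ G] (n : ℕ) :
    ∀ (V : Type*) [AddCommGroup V] [Module ℂ V] [LieRingModule G V] [LieModule ℂ G V]
      [FiniteDimensional ℂ V], finrank ℂ V = n → ∀ c : G →ₗ[ℂ] V,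
      (∀ x y, c ⁅x, y⁆ = ⁅x, c y⁆ - ⁅y, c x⁆) → ∃ v, ∀ x, c x = ⁅x, v⁆ := by
  induction n using Nat.strong_induction_on with
  | _ n ih =>
  intro V _ _ _ _ _ hn c hc
  classical
  by_cases hB : LieModule.traceForm ℂ G V = 0
  · refine ⟨0, fun x => ?_⟩
    rw [lie_zero]
    refine plPerfectInd (LinearMap.ker c) ?_ x
    intro x y
    rw [LinearMap.mem_ker, hc, plTrivial hB, plTrivial hB, sub_zero]
  have hnd := plNondeg hB
  set B := LieModule.traceForm ℂ G V with hBdef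
  let b := Module.finBasis ℂ G
  let b' := LinearMap.BilinForm.dualBasis B hnd b
  have hsymm : ∀ x y, B x y = B y x := LieModule.traceForm_comm ℂ G V
  have hbb' : ∀ i j, B (b' i) (b j) = if j = i then 1 else 0 := by
    intro i j; exact LinearMap.BilinForm.apply_dualBasis_left ..
  have h1 : ∀ x, x = ∑ j, B x (b' j) • b j := by
    intro x
    have e := b.sum_repr x
    have : ∀ j, B x (b' j) = b.repr x j := by
      intro j
      conv_lhs => rw [← e, hsymm]
      simp only [map_sum, map_smul, LinearMap.sum_apply, LinearMap.smul_apply, hbb', smul_eq_mul,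
        mul_ite, mul_one, mul_zero, Finset.sum_ite_eq, Finset.sum_ite_eq', Finset.mem_univ, if_true]
    simp only [this]
    exact e.symm
  have h2 : ∀ x, x = ∑ j, B (b j) x • b' j := by
    intro x
    have e := b'.sum_repr x
    have : ∀ j, B (b j) x = b'.repr x j := by
      intro j
      conv_lhs => rw [← e, hsymm]
      simp only [map_sum, map_smul, LinearMap.sum_apply, LinearMap.smul_apply, hbb', smul_eq_mul,
        mul_ite, mul_one, mul_zero, Finset.sum_ite_eq, Finset.sum_ite_eq', Finset.mem_univ, if_true]
    simp only [this]
    exact e.symm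
  have hinv : ∀ x y z : G, B ⁅x, y⁆ z = - B y ⁅x, z⁆ := by
    intro x y z
    rw [← lie_skew, map_neg, LinearMap.neg_apply, hBdef, LieModule.traceForm_apply_lie_apply]
  let φ := LieModule.toEnd ℂ G V
  let A : Module.End ℂ V := ∑ i, φ (b i) * φ (b' i)
  have hAapp : ∀ v, A v = ∑ i, ⁅b i, ⁅b' i, v⁆⁆ := by
    intro v; simp [A, φ, LinearMap.sum_apply]
  have hAcomm : ∀ (y : G) (v : V), A ⁅y, v⁆ = ⁅y, A v⁆ := by
    intro y v
    let T : G →ₗ[ℂ] G →ₗ[ℂ] V := LinearMap.mk₂ ℂ (fun p q => ⁅p, ⁅q, v⁆⁆)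
      (by intros; simp) (by intros; simp) (by intros; simp) (by intros; simp)
    have := plDual B b b' h1 h2 hinv T y
    simp only [T, LinearMap.mk₂_apply] at this
    rw [hAapp, hAapp, lie_sum, ← sub_eq_zero, ← neg_eq_zero, ← this, ← Finset.sum_sub_distrib,
      ← Finset.sum_neg_distrib]
    refine Finset.sum_congr rfl fun i _ => ?_
    simp only [lie_lie, lie_sub]
    abel
  let w := ∑ i, ⁅b i, c (b' i)⁆
  have hw : ∀ y, A (c y) = ⁅y, w⁆ := by
    intro y
    let T : G →ₗ[ℂ] G →ₗ[ℂ] V := LinearMap.mk₂ ℂ (fun p q => ⁅p, c q⁆)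
      (by intros; simp) (by intros; simp) (by intros; simp) (by intros; simp)
    have := plDual B b b' h1 h2 hinv T y
    simp only [T, LinearMap.mk₂_apply] at this
    rw [hAapp, lie_sum, ← sub_eq_zero, ← neg_eq_zero, ← this, ← Finset.sum_sub_distrib,
      ← Finset.sum_neg_distrib]
    refine Finset.sum_congr rfl fun i _ => ?_
    simp only [lie_lie, lie_sub, hc]
    abel
  have hpow : ∀ (m : ℕ) (y : G) (v : V), (A ^ m) ⁅y, v⁆ = ⁅y, (A ^ m) v⁆ := by
    intro m
    induction m with
    | zero => intros; simp
    | succ m ihm => intro y v; rw [pow_succ, Module.End.mul_apply, hAcomm, ihm, Module.End.mul_apply]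
  have htr : LinearMap.trace ℂ V A ≠ 0 := by
    have : LinearMap.trace ℂ V A = (finrank ℂ G : ℂ) := by
      have e : ∀ i, LinearMap.trace ℂ V (φ (b i) * φ (b' i)) = 1 := by
        intro i
        have := hbb' i i
        rw [hsymm, if_pos rfl] at this
        exact this
      simp [A, map_sum, e]
    rw [this]
    have := LieAlgebra.IsSimple.nontrivial ℂ G
    exact_mod_cast (Module.finrank_pos (R := ℂ) (M := G)).ne'
  obtain ⟨m, hm⟩ := IsArtinian.monotone_stabilizes (LinearMap.iterateRange A)
  have hm1 : LinearMap.range (A ^ m) = LinearMap.range (A ^ (m+1)) := hm (m+1) (Nat.le_succ m)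
  obtain ⟨u, hu⟩ : (A ^ m) w ∈ LinearMap.range (A ^ (m+1)) := by
    rw [← hm1]; exact ⟨w, rfl⟩
  let K : LieSubmodule ℂ G V :=
    { LinearMap.ker (A ^ (m+1)) with
      lie_mem := by
        intro x v hv
        have hv' : (A ^ (m+1)) v = 0 := hv
        change (A ^ (m+1)) ⁅x, v⁆ = 0
        rw [hpow, hv', lie_zero] }
  have hKm : ∀ v, v ∈ K ↔ (A ^ (m+1)) v = 0 := fun v => Iff.rfl
  have hcK : ∀ y, c y - ⁅y, u⁆ ∈ K := by
    intro y
    rw [hKm, map_sub, hpow, hu, pow_succ, Module.End.mul_apply, hw, hpow, sub_self]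
  have hKlt : finrank ℂ K < n := by
    rw [← hn]
    refine Submodule.finrank_lt (s := K.toSubmodule) ?_
    intro htop
    apply htr
    have hnil : IsNilpotent A := by
      refine ⟨m+1, ?_⟩
      ext v
      have : v ∈ K.toSubmodule := by rw [htop]; trivial
      exact this
    exact (LinearMap.isNilpotent_trace_of_isNilpotent hnil).eq_zero
  let c' : G →ₗ[ℂ] K :=
    { toFun := fun y => ⟨c y - ⁅y, u⁆, hcK y⟩
      map_add' := by intro x y; ext; simp; abel
      map_smul' := by intro r x; ext; simp [smul_sub] }
  obtain ⟨v, hv⟩ := ih _ hKlt K rfl c' (by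
    intro x y
    ext
    simp [c', hc]
    abel)
  refine ⟨v + u, fun x => ?_⟩
  have := congrArg Subtype.val (hv x)
  simp only [c', LinearMap.coe_mk, AddHom.coe_mk, LieSubmodule.coe_bracket] at this
  rw [lie_add, ← this]
  abel

theorem plWhiteheadRel {G H : Type*} [LieRing G] [LieAlgebra ℂ G] [LieAlgebra.IsSimple ℂ G]
    [FiniteDimensional ℂ G] [LieRing H] [LieAlgebra ℂ H] [FiniteDimensional ℂ H]
    (ι : G →ₗ⁅ℂ⁆ H) (U U' : LieIdeal ℂ H) (c : G →ₗ[ℂ] H) (hcU : ∀ x, c x ∈ U)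
    (hc : ∀ x y, c ⁅x, y⁆ - (⁅ι x, c y⁆ - ⁅ι y, c x⁆) ∈ U') :
    ∃ v ∈ U, ∀ x, c x - ⁅ι x, v⁆ ∈ U' := by
  let _ : LieRingModule G H := LieRingModule.compLieHom H ι
  let _ : LieModule ℂ G H := LieModule.compLieHom H ι
  have hb : ∀ (x : G) (z : H), ⁅x, z⁆ = ⁅ι x, z⁆ := fun _ _ => rfl
  let U₁ : LieSubmodule ℂ G H :=
    { U.toSubmodule with lie_mem := fun {x z} hz => U.lie_mem (x := ι x) hz }
  let U₂ : LieSubmodule ℂ G H :=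
    { U'.toSubmodule with lie_mem := fun {x z} hz => U'.lie_mem (x := ι x) hz }
  let P : LieSubmodule ℂ G U₁ := U₂.comap U₁.incl
  let c₁ : G →ₗ[ℂ] U₁ := c.codRestrict U₁.toSubmodule hcU
  let c₂ : G →ₗ[ℂ] (U₁ ⧸ P) := (LieSubmodule.Quotient.mk' P : U₁ →ₗ[ℂ] U₁ ⧸ P) ∘ₗ c₁
  obtain ⟨v, hv⟩ := plWhitehead _ (U₁ ⧸ P) rfl c₂ (by
    intro x y
    rw [← sub_eq_zero]
    have : c₁ ⁅x, y⁆ - (⁅x, c₁ y⁆ - ⁅y, c₁ x⁆) ∈ P := hc x y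
    rw [← LieSubmodule.Quotient.mk_eq_zero'] at this
    exact this)
  obtain ⟨v, rfl⟩ := LieSubmodule.Quotient.surjective_mk' P v
  refine ⟨v, v.2, fun x => ?_⟩
  have h := hv x
  rw [← sub_eq_zero] at h
  have h3 : LieSubmodule.Quotient.mk (N := P) (c₁ x - ⁅x, v⁆) = 0 := h
  rw [LieSubmodule.Quotient.mk_eq_zero'] at h3
  exact h3

/-- no left-symmetric structure on a simple Lie algebra, in orbit form -/
theorem plOrbit {G V : Type*} [LieRing G] [LieAlgebra ℂ G] [LieAlgebra.IsSimple ℂ G]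
    [FiniteDimensional ℂ G] [AddCommGroup V] [Module ℂ V] [LieRingModule G V] [LieModule ℂ G V]
    (v : V) (φ : G ≃ₗ[ℂ] V) (hφ : ∀ x, φ x = ⁅x, v⁆) : False := by
  let e := φ.symm v
  have he : ⁅e, v⁆ = v := by rw [← hφ]; simp [e]
  have key : LieModule.toEnd ℂ G V e = φ.conj (LieModule.toEnd ℂ G G e + 1) := by
    ext z
    obtain ⟨y, rfl⟩ := φ.surjective z
    simp only [LinearEquiv.conj_apply, LinearMap.comp_apply, LinearEquiv.coe_coe,
      LinearEquiv.symm_apply_apply, LinearMap.add_apply, LieModule.toEnd_apply_apply,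
      Module.End.one_apply, map_add]
    rw [hφ ⁅e, y⁆, lie_lie, he, hφ y]
    abel
  have t := congrArg (LinearMap.trace ℂ V) key
  rw [plTrace, LinearMap.trace_conj', map_add, plTrace, LinearMap.trace_one, zero_add] at t
  have := LieAlgebra.IsSimple.nontrivial ℂ G
  have := (Module.finrank_pos (R := ℂ) (M := G)).ne'
  exact this (by exact_mod_cast t.symm)

theorem plNilp {H : Type*} [LieRing H] [LieAlgebra ℂ H] [FiniteDimensional ℂ H]
    (I : LieIdeal ℂ H) [LieAlgebra.IsSolvable I]
    (hI : I ≤ ⁅(⊤ : LieIdeal ℂ H), (⊤ : LieIdeal ℂ H)⁆) (n : ℕ) :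
    ∀ (W : Type*) [AddCommGroup W] [Module ℂ W] [LieRingModule H W] [LieModule ℂ H W]
      [FiniteDimensional ℂ W], finrank ℂ W = n →
      ∀ y ∈ I, IsNilpotent (LieModule.toEnd ℂ H W y) := by
  induction n using Nat.strong_induction_on with
  | _ n ih =>
  intro W _ _ _ _ _ hn y hy
  rcases subsingleton_or_nontrivial W with hW | hW
  · exact ⟨1, Subsingleton.elim _ _⟩
  obtain ⟨χ, hχ⟩ := LieModule.exists_nontrivial_weightSpace_of_isSolvable ℂ I W
  let W' : LieSubmodule ℂ H W := LieModule.weightSpaceOfIsLieTower ℂ W χ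
  have hmem : ∀ w ∈ W', ∀ a : I, ⁅(a : H), w⁆ = χ a • w := by
    intro w hw a
    have hw' : w ∈ LieModule.weightSpace W χ := hw
    exact (LieModule.mem_weightSpace _ _).1 hw' a
  have hW'n : Nontrivial W' := hχ
  have htr : ∀ z ∈ I, LinearMap.trace ℂ W' (LieModule.toEnd ℂ H W' z) = 0 := by
    intro z hz
    have hz' : z ∈ (⁅(⊤ : LieIdeal ℂ H), (⊤ : LieIdeal ℂ H)⁆ : LieIdeal ℂ H).toSubmodule := hI hz
    rw [LieSubmodule.lieIdeal_oper_eq_linear_span'] at hz'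
    suffices h : z ∈ LinearMap.ker
        (LinearMap.trace ℂ W' ∘ₗ (LieModule.toEnd ℂ H W' : H →ₗ[ℂ] Module.End ℂ W')) by
      simpa using h
    refine Submodule.span_le.2 ?_ hz'
    rintro _ ⟨a, -, b, -, rfl⟩
    simp
  have hχ0 : ∀ a : I, χ a = 0 := by
    intro a
    have e : LieModule.toEnd ℂ H W' (a : H) = χ a • 1 := by
      ext w
      simpa using hmem w w.2 a
    have t := htr a a.2
    rw [e, map_smul, LinearMap.trace_one, smul_eq_mul, mul_eq_zero] at t
    rcases t with t | t
    · exact t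
    · exact absurd (by exact_mod_cast t) (Module.finrank_pos (R := ℂ) (M := W')).ne'
  have hlt : finrank ℂ (W ⧸ W') < n := by
    rw [← hn]
    have h1 := Submodule.finrank_quotient_add_finrank (W'.toSubmodule)
    have h2 : 0 < finrank ℂ W'.toSubmodule := Module.finrank_pos (R := ℂ) (M := W')
    change finrank ℂ (W ⧸ W'.toSubmodule) < _
    omega
  obtain ⟨k, hk⟩ := ih _ hlt (W ⧸ W') rfl y hy
  refine ⟨k+1, ?_⟩
  ext w
  have hq : ∀ (j : ℕ) (w : W), LieSubmodule.Quotient.mk (N := W') ((LieModule.toEnd ℂ H W y ^ j) w) =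
      (LieModule.toEnd ℂ H (W ⧸ W') y ^ j) (LieSubmodule.Quotient.mk w) := by
    intro j
    induction j with
    | zero => intro w; rfl
    | succ j ihj =>
      intro w
      rw [pow_succ, Module.End.mul_apply, ihj, pow_succ, Module.End.mul_apply]
      rfl
  have h1 := hq k w
  rw [hk, LinearMap.zero_apply, LieSubmodule.Quotient.mk_eq_zero'] at h1
  rw [pow_succ', Module.End.mul_apply, LieModule.toEnd_apply_apply]
  have := hmem _ h1 ⟨y, hy⟩
  rw [hχ0, zero_smul] at this
  simpa using this

section
variable {H : Type*} [LieRing H] [LieAlgebra ℂ H] 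

theorem plPow (I : LieIdeal ℂ H) (v w z : H) (hv : v ∈ I) (k : ℕ) (hk : I.lcs H (k+1) ≤ I)
    (hw : w ∈ I.lcs H (k+1)) (i : ℕ) :
    (LieAlgebra.ad ℂ H (v - w) ^ (i+1)) z ∈ I ∧
    (LieAlgebra.ad ℂ H (v - w) ^ (i+1)) z - (LieAlgebra.ad ℂ H v ^ (i+1)) z ∈ I.lcs H (k+1) ∧
    (LieAlgebra.ad ℂ H (v - w) ^ (i+2)) z - (LieAlgebra.ad ℂ H v ^ (i+2)) z ∈ I.lcs H (k+2) := by
  have hvw : v - w ∈ I := sub_mem hv (hk hw)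
  have hle : I.lcs H (k+2) ≤ I.lcs H (k+1) := by
    rw [LieIdeal.lcs_succ]; exact LieSubmodule.lie_le_right _ _
  have hA : ∀ i, (LieAlgebra.ad ℂ H (v - w) ^ (i+1)) z ∈ I := by
    intro i
    rw [pow_succ', Module.End.mul_apply, LieAlgebra.ad_apply]
    exact lie_mem_left ℂ H I _ _ hvw
  have step : ∀ i, (LieAlgebra.ad ℂ H (v - w) ^ (i+1)) z - (LieAlgebra.ad ℂ H v ^ (i+1)) z
      ∈ I.lcs H (k+1) → (LieAlgebra.ad ℂ H (v - w) ^ (i+2)) z - (LieAlgebra.ad ℂ H v ^ (i+2)) z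
      ∈ I.lcs H (k+2) := by
    intro i hi
    have e : (LieAlgebra.ad ℂ H (v - w) ^ (i+2)) z - (LieAlgebra.ad ℂ H v ^ (i+2)) z =
      ⁅v, (LieAlgebra.ad ℂ H (v - w) ^ (i+1)) z - (LieAlgebra.ad ℂ H v ^ (i+1)) z⁆
      + ⁅(LieAlgebra.ad ℂ H (v - w) ^ (i+1)) z, w⁆ := by
      rw [pow_succ' _ (i+1), pow_succ' _ (i+1), Module.End.mul_apply, Module.End.mul_apply,
        LieAlgebra.ad_apply, LieAlgebra.ad_apply, sub_lie, lie_sub, ← lie_skew w]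
      abel
    rw [e, LieIdeal.lcs_succ]
    exact add_mem (LieSubmodule.lie_mem_lie hv hi) (LieSubmodule.lie_mem_lie (hA i) hw)
  have hD : ∀ i, (LieAlgebra.ad ℂ H (v - w) ^ (i+1)) z - (LieAlgebra.ad ℂ H v ^ (i+1)) z
      ∈ I.lcs H (k+1) := by
    intro i
    induction i with
    | zero =>
      have : (LieAlgebra.ad ℂ H (v - w) ^ (0+1)) z - (LieAlgebra.ad ℂ H v ^ (0+1)) z = -⁅w, z⁆ := by
        simp
      rw [this]
      exact neg_mem (lie_mem_left ℂ H _ _ _ hw)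
    | succ i ih => exact hle (step i ih)
  exact ⟨hA i, hD i, step i (hD i)⟩

theorem plExp [LieAlgebra ℚ H] (I : LieIdeal ℂ H) (v w z : H) (hv : v ∈ I) (k : ℕ) (hk : I.lcs H (k+1) ≤ I)
    (hw : w ∈ I.lcs H (k+1)) (hnil : ∀ y ∈ I, IsNilpotent (LieAlgebra.ad ℂ H y)) :
    IsNilpotent.exp (LieAlgebra.ad ℂ H (v - w)) z - IsNilpotent.exp (LieAlgebra.ad ℂ H v) z + ⁅w, z⁆
      ∈ I.lcs H (k+2) := by
  obtain ⟨a, ha⟩ := hnil _ hv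
  obtain ⟨b, hb⟩ := hnil _ (sub_mem hv (hk hw))
  rw [IsNilpotent.exp_eq_sum (pow_eq_zero_of_le (show a ≤ a + b + 2 by omega) ha),
    IsNilpotent.exp_eq_sum (pow_eq_zero_of_le (show b ≤ a + b + 2 by omega) hb),
    LinearMap.sum_apply, LinearMap.sum_apply, ← Finset.sum_sub_distrib,
    Finset.sum_range_succ', Finset.sum_range_succ']
  have e : ∀ S : H, S + (((0+1).factorial : ℚ)⁻¹ • LieAlgebra.ad ℂ H (v - w) ^ (0+1)) z
     - (((0+1).factorial : ℚ)⁻¹ • LieAlgebra.ad ℂ H v ^ (0+1)) z + ⁅w, z⁆ = S := by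
    intro S; simp; abel
  have e0 : (((0).factorial : ℚ)⁻¹ • LieAlgebra.ad ℂ H (v - w) ^ (0)) z
     - (((0).factorial : ℚ)⁻¹ • LieAlgebra.ad ℂ H v ^ (0)) z = 0 := by
    simp
  rw [e0, add_zero, ← add_sub_assoc, e]
  refine sum_mem fun i _ => ?_
  rw [LinearMap.smul_apply, LinearMap.smul_apply, ← smul_sub, 
     ← Rat.cast_smul_eq_qsmul ℂ]
  exact Submodule.smul_mem _ _ (plPow I v w z hv k hk hw i).2.2
end

theorem plSolv {G H : Type*} [LieRing G] [LieAlgebra ℂ G] [LieAlgebra.IsSimple ℂ G]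
    [FiniteDimensional ℂ G] [LieRing H] [LieAlgebra ℂ H] [LieAlgebra ℚ H] [FiniteDimensional ℂ H]
    (ι ρ : G →ₗ⁅ℂ⁆ H) (I : LieIdeal ℂ H) [LieAlgebra.IsSolvable I]
    (σ : G ≃ₗ[ℂ] I) (hσ : ∀ x, (σ x : H) = ρ x - ι x) : False := by
  -- the cocycle modulo a smaller ideal
  have hcoc : ∀ (θ : G →ₗ⁅ℂ⁆ H) (J : LieIdeal ℂ H), (∀ x, θ x - ι x ∈ I) →
      (∀ x, ρ x - θ x ∈ J) → ∃ v ∈ J, ∀ x, ρ x - θ x - ⁅ι x, v⁆ ∈ ⁅I, J⁆ := by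
    intro θ J hθ hJ
    refine plWhiteheadRel ι J ⁅I, J⁆ ((ρ : G →ₗ[ℂ] H) - (θ : G →ₗ[ℂ] H)) hJ ?_
    intro x y
    have e : ((ρ : G →ₗ[ℂ] H) - (θ : G →ₗ[ℂ] H)) ⁅x, y⁆ -
      (⁅ι x, ((ρ : G →ₗ[ℂ] H) - (θ : G →ₗ[ℂ] H)) y⁆ - ⁅ι y, ((ρ : G →ₗ[ℂ] H) - (θ : G →ₗ[ℂ] H)) x⁆)
      = ⁅(σ x : H), ρ y - θ y⁆ - ⁅θ y - ι y, ρ x - θ x⁆ := by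
      simp only [LinearMap.sub_apply, LieHom.coe_toLinearMap, LieHom.map_lie, hσ, sub_lie, lie_sub]
      rw [← lie_skew (θ y) (ρ x), ← lie_skew (θ y) (θ x)]
      abel
    rw [e]
    exact sub_mem (LieSubmodule.lie_mem_lie (σ x).2 (hJ y)) (LieSubmodule.lie_mem_lie (hθ y) (hJ x))
  have hρι : ∀ x, ρ x - ι x ∈ I := fun x => by rw [← hσ]; exact (σ x).2
  have hI1 : I ≤ ⁅I, (⊤ : LieIdeal ℂ H)⁆ := by
    obtain ⟨v, hv, hv'⟩ := hcoc ι I (by simp) hρι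
    intro z hz
    obtain ⟨x, hx⟩ := σ.surjective ⟨z, hz⟩
    have hx' : z = ρ x - ι x := by rw [← hσ, hx]
    have h1 : ρ x - ι x - ⁅ι x, v⁆ ∈ ⁅I, (⊤ : LieIdeal ℂ H)⁆ :=
      LieSubmodule.mono_lie_right _ le_top (hv' x)
    have h2 : ⁅ι x, v⁆ ∈ ⁅I, (⊤ : LieIdeal ℂ H)⁆ := by
      rw [← lie_skew]
      exact neg_mem (LieSubmodule.lie_mem_lie hv (LieSubmodule.mem_top _))
    rw [hx']
    simpa using add_mem h1 h2
  have hnil : ∀ y ∈ I, IsNilpotent (LieAlgebra.ad ℂ H y) :=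
    plNilp I (hI1.trans (LieSubmodule.mono_lie_left _ le_top)) _ H rfl
  have hlcs1 : ∀ k, I.lcs H (k+1) ≤ I := by
    intro k
    rw [LieIdeal.lcs_succ]; exact LieSubmodule.lie_le_left _ _
  have hN : ∃ k, I.lcs H (k+1) = ⊥ := by
    have hn : LieModule.IsNilpotent I H := by
      rw [LieModule.isNilpotent_iff_forall' (R := ℂ)]
      intro x
      exact hnil x x.2
    obtain ⟨k, hk⟩ := (LieModule.isNilpotent_iff ℂ I H).1 hn
    have h2 : I.lcs H k = ⊥ := by
      rw [← LieSubmodule.toSubmodule_inj, LieIdeal.coe_lcs_eq, hk]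
      rfl
    refine ⟨k, ?_⟩
    rw [LieIdeal.lcs_succ, h2]
    simp
  have hexpI : ∀ v (hv : v ∈ I), ∃ θ : G →ₗ⁅ℂ⁆ H,
      ∀ x, θ x = IsNilpotent.exp (LieAlgebra.ad ℂ H v) (ι x) := by
    intro v hv
    have h : IsNilpotent (LieDerivation.ad ℂ H v).toLinearMap := by
      have e : (LieDerivation.ad ℂ H v).toLinearMap = LieAlgebra.ad ℂ H v := by
        ext z; simp
      rw [e]; exact hnil v hv
    refine ⟨(LieDerivation.exp _ h : H →ₗ⁅ℂ⁆ H).comp ι, fun x => ?_⟩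
    have e : (LieDerivation.ad ℂ H v).toLinearMap = LieAlgebra.ad ℂ H v := by
      ext z; simp
    rw [← e]
    rfl
  have hmain : ∀ k, ∃ v ∈ I, ∀ x,
      ρ x - IsNilpotent.exp (LieAlgebra.ad ℂ H v) (ι x) ∈ I.lcs H (k+1) := by
    intro k
    induction k with
    | zero =>
      refine ⟨0, zero_mem _, fun x => ?_⟩
      have : IsNilpotent.exp (LieAlgebra.ad ℂ H 0) (ι x) = ι x := by simp
      rw [this]
      exact hI1 (hρι x)
    | succ k ih =>
      obtain ⟨v, hv, h⟩ := ih
      obtain ⟨θ, hθ⟩ := hexpI v hv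
      have hJ : ∀ x, ρ x - θ x ∈ I.lcs H (k+1) := fun x => by rw [hθ]; exact h x
      obtain ⟨w, hw, hw'⟩ := hcoc θ (I.lcs H (k+1)) (fun x => by
        have := sub_mem (hρι x) (hlcs1 k (hJ x))
        simpa using this) hJ
      refine ⟨v - w, sub_mem hv (hlcs1 k hw), fun x => ?_⟩
      have h1 := plExp I v w (ι x) hv k (hlcs1 k) hw hnil
      have h2 : ρ x - θ x - ⁅ι x, w⁆ ∈ I.lcs H (k+2) := by
        rw [LieIdeal.lcs_succ]; exact hw' x
      have := sub_mem h2 h1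
      rw [hθ, ← lie_skew] at this
      convert this using 1
      abel
  obtain ⟨k, hk⟩ := hN
  obtain ⟨v, hv, h⟩ := hmain k
  rw [hk] at h
  have hρ : ∀ x, ρ x = IsNilpotent.exp (LieAlgebra.ad ℂ H v) (ι x) := by
    intro x
    have := h x
    rw [LieSubmodule.mem_bot, sub_eq_zero] at this
    exact this
  let _ : LieRingModule G I := LieRingModule.compLieHom I ι
  let _ : LieModule ℂ G I := LieModule.compLieHom I ι
  have hb : ∀ (x : G) (z : I), ((⁅x, z⁆ : I) : H) = ⁅ι x, (z : H)⁆ := fun _ _ => rfl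
  let v' : I := ⟨v, hv⟩
  let φ : G →ₗ[ℂ] I := (LieModule.toEnd ℂ G I : G →ₗ[ℂ] Module.End ℂ I).flip v'
  have hφ : ∀ x, φ x = ⁅x, v'⁆ := fun x => rfl
  have hinj : Function.Injective φ := by
    rw [injective_iff_map_eq_zero]
    intro x hx
    rw [hφ] at hx
    have h1 : ⁅ι x, v⁆ = 0 := by
      have := congrArg Subtype.val hx
      rw [hb] at this
      exact this
    have h2 : LieAlgebra.ad ℂ H v (ι x) = 0 := by
      rw [LieAlgebra.ad_apply, ← lie_skew, h1, neg_zero]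
    have h3 : ρ x = ι x := by
      rw [hρ]
      obtain ⟨a, ha⟩ := hnil _ hv
      rw [IsNilpotent.exp_eq_sum (pow_eq_zero_of_le (show a ≤ a + 1 by omega) ha),
        LinearMap.sum_apply, Finset.sum_range_succ']
      rw [Finset.sum_eq_zero]
      · simp
      · intro i _
        rw [LinearMap.smul_apply, pow_succ, Module.End.mul_apply, h2, map_zero, smul_zero]
    have h4 : (σ x : H) = 0 := by rw [hσ, h3, sub_self]
    have h5 : σ x = 0 := Subtype.ext h4
    simpa using h5
  exact plOrbit v' (LinearEquiv.ofInjectiveOfFinrankEq φ hinj σ.finrank_eq) (fun x => rfl)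

/-- the quotient map as a homomorphism of Lie algebras -/
def plMk {L : Type*} [LieRing L] [LieAlgebra ℂ L] (I : LieIdeal ℂ L) : L →ₗ⁅ℂ⁆ L ⧸ I :=
  { (LieSubmodule.Quotient.mk' I : L →ₗ[ℂ] L ⧸ I) with
    map_lie' := by
      intro x y
      exact LieSubmodule.Quotient.mk_bracket I x y }

theorem plMk_surj {L : Type*} [LieRing L] [LieAlgebra ℂ L] (I : LieIdeal ℂ L) :
    Function.Surjective (plMk I) := LieSubmodule.Quotient.surjective_mk' I

theorem plMk_eq_zero {L : Type*} [LieRing L] [LieAlgebra ℂ L] (I : LieIdeal ℂ L) (x : L) :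
    plMk I x = 0 ↔ x ∈ I := LieSubmodule.Quotient.mk_eq_zero I

theorem plRad {H : Type*} [LieRing H] [LieAlgebra ℂ H] [FiniteDimensional ℂ H] :
    LieAlgebra.HasTrivialRadical ℂ (H ⧸ LieAlgebra.radical ℂ H) := by
  rw [LieAlgebra.hasTrivialRadical_iff_no_abelian_ideals]
  intro J hJ
  have hJ' : ⁅J, J⁆ = ⊥ := (LieSubmodule.lie_abelian_iff_lie_self_eq_bot J).1 hJ
  let f := plMk (LieAlgebra.radical ℂ H)
  let K := J.comap f
  have hK : ⁅K, K⁆ ≤ LieAlgebra.radical ℂ H := by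
    intro x hx
    have h1 := LieIdeal.comap_bracket_le f (J₁ := J) (J₂ := J) hx
    rw [hJ', LieIdeal.mem_comap, LieSubmodule.mem_bot] at h1
    exact (plMk_eq_zero _ _).1 h1
  obtain ⟨k, hk⟩ := LieAlgebra.IsSolvable.solvable ℂ (LieAlgebra.radical ℂ H)
  rw [LieIdeal.derivedSeries_eq_bot_iff] at hk
  have hs : LieAlgebra.IsSolvable K := by
    refine LieAlgebra.IsSolvable.mk (R := ℂ) (k := k + 1) ?_
    rw [LieIdeal.derivedSeries_eq_bot_iff, LieAlgebra.derivedSeriesOfIdeal_add, eq_bot_iff, ← hk]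
    refine LieAlgebra.derivedSeriesOfIdeal_mono ?_ k
    simpa using hK
  rw [LieAlgebra.LieIdeal.solvable_iff_le_radical] at hs
  rw [eq_bot_iff]
  intro y hy
  obtain ⟨x, rfl⟩ := plMk_surj _ y
  rw [LieSubmodule.mem_bot, plMk_eq_zero]
  exact hs (LieIdeal.mem_comap.2 hy)

theorem plSplit.{u} {H : Type u} [LieRing H] [LieAlgebra ℂ H] [FiniteDimensional ℂ H]
    (I : LieIdeal ℂ H) (hI : ¬ LieAlgebra.IsSolvable I) :
    ∃ (L : Type u) (_ : LieRing L) (_ : LieAlgebra ℂ L) (q : H →ₗ⁅ℂ⁆ L), Nontrivial L ∧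
      ∀ y : L, ∃ x ∈ I, q x = y := by
  let R := LieAlgebra.radical ℂ H
  have := plRad (H := H)
  let S : LieIdeal ℂ (H ⧸ R) := I.map (plMk R)
  have hS := S.isCompl_killingCompl
  refine ⟨(H ⧸ R) ⧸ S.killingCompl, inferInstance, inferInstance,
    (plMk S.killingCompl).comp (plMk R), ?_, ?_⟩
  · by_contra hn
    rw [not_nontrivial_iff_subsingleton] at hn
    apply hI
    rw [LieAlgebra.LieIdeal.solvable_iff_le_radical]
    intro x hx
    rw [← plMk_eq_zero]
    have h1 : plMk R x ∈ S := LieIdeal.mem_map hx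
    have h2 : plMk R x ∈ S.killingCompl := by
      rw [← plMk_eq_zero]; exact Subsingleton.elim _ _
    have := hS.inf_eq_bot
    have h3 : plMk R x ∈ S ⊓ S.killingCompl := ⟨h1, h2⟩
    rw [this] at h3
    simpa using h3
  · intro y
    obtain ⟨z, rfl⟩ := plMk_surj _ y
    have hz : z ∈ S ⊔ S.killingCompl := by rw [hS.sup_eq_top]; trivial
    rw [LieSubmodule.mem_sup] at hz
    obtain ⟨s, hs, t, ht, rfl⟩ := hz
    obtain ⟨x, hx⟩ := LieIdeal.mem_map_of_surjective (plMk_surj R) hs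
    refine ⟨x, x.2, ?_⟩
    rw [LieHom.comp_apply, hx, map_add, (plMk_eq_zero _ t).2 ht, add_zero]

theorem plInj {G L : Type*} [LieRing G] [LieAlgebra ℂ G] [LieAlgebra.IsSimple ℂ G]
    [LieRing L] [LieAlgebra ℂ L] (f : G →ₗ⁅ℂ⁆ L) (x : G) (hx : f x ≠ 0) : Function.Injective f := by
  rw [← LieHom.ker_eq_bot]
  rcases LieAlgebra.IsSimple.eq_bot_or_eq_top (R := ℂ) f.ker with h | h
  · exact h
  · exact absurd (LieHom.mem_ker.1 (h ▸ LieSubmodule.mem_top x)) hx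

theorem plIso {G N L : Type*} [LieRing G] [LieAlgebra ℂ G] [LieRing N] [LieAlgebra ℂ N]
    [FiniteDimensional ℂ G] [LieRing L] [LieAlgebra ℂ L] (e : G ≃ₗ[ℂ] N)
    (f : N →ₗ⁅ℂ⁆ L) (hf : Function.Surjective f) (g : G →ₗ⁅ℂ⁆ L) (hg : Function.Injective g) :
    Nonempty (N ≃ₗ⁅ℂ⁆ G) := by
  have : FiniteDimensional ℂ N := e.finiteDimensional
  have : FiniteDimensional ℂ L := Module.Finite.of_surjective (f : N →ₗ[ℂ] L) hf
  have h1 : finrank ℂ G ≤ finrank ℂ L :=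
    LinearMap.finrank_le_finrank_of_injective (f := (g : G →ₗ[ℂ] L)) hg
  have h2 : finrank ℂ L ≤ finrank ℂ N :=
    LinearMap.finrank_le_finrank_of_surjective (f := (f : N →ₗ[ℂ] L)) hf
  have h3 := e.finrank_eq
  have hf' : Function.Injective f :=
    (LinearMap.injective_iff_surjective_of_finrank_eq_finrank
      (f := (f : N →ₗ[ℂ] L)) (by omega)).2 hf
  have hg' : Function.Surjective g :=
    (LinearMap.injective_iff_surjective_of_finrank_eq_finrank
      (f := (g : G →ₗ[ℂ] L)) (by omega)).1 hg
  exact ⟨(LieEquiv.ofBijective f ⟨hf', hf⟩).trans (LieEquiv.ofBijective g ⟨hg, hg'⟩).symm⟩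

theorem plRatLie (H : Type*) [LieRing H] [LieAlgebra ℂ H] : Nonempty (LieAlgebra ℚ H) := by
  let _ : Module ℚ H := Module.compHom H (algebraMap ℚ ℂ)
  exact ⟨{ lie_smul := fun t x y => lie_smul ((algebraMap ℚ ℂ) t) x y }⟩

/-- left multiplications as derivations -/
noncomputable def plPsi {G N : Type*} [LieRing G] [LieAlgebra ℂ G] [LieRing N] [LieAlgebra ℂ N]
    (e : G ≃ₗ[ℂ] N) (p : G →ₗ[ℂ] G →ₗ[ℂ] G) (hp : IsPostLieStruct e p) :
    G →ₗ⁅ℂ⁆ LieDerivation ℂ N N where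
  toFun x :=
    { toLinearMap := e.toLinearMap ∘ₗ p x ∘ₗ e.symm.toLinearMap
      leibniz' := by
        intro a b
        have := hp.ax3 x (e.symm a) (e.symm b)
        simp only [LinearEquiv.apply_symm_apply] at this
        simp only [LinearMap.comp_apply, LinearEquiv.coe_coe, this, map_add,
          LinearEquiv.apply_symm_apply]
        rw [← lie_skew b]
        abel }
  map_add' x y := by ext a; simp
  map_smul' t x := by ext a; simp
  map_lie' := by
    intro x y
    ext a
    simp [LieDerivation.lie_apply, hp.ax2]

theorem plPsi_apply {G N : Type*} [LieRing G] [LieAlgebra ℂ G] [LieRing N] [LieAlgebra ℂ N]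
    (e : G ≃ₗ[ℂ] N) (p : G →ₗ[ℂ] G →ₗ[ℂ] G) (hp : IsPostLieStruct e p) (x : G) (a : N) :
    plPsi e p hp x a = e (p x (e.symm a)) := rfl

/-- the graph embedding -/
noncomputable def plRho {G N : Type*} [LieRing G] [LieAlgebra ℂ G] [LieRing N] [LieAlgebra ℂ N]
    (e : G ≃ₗ[ℂ] N) (p : G →ₗ[ℂ] G →ₗ[ℂ] G) (hp : IsPostLieStruct e p) :
    G →ₗ⁅ℂ⁆ LieAlgebra.SemiDirectSum N G (plPsi e p hp) where
  toFun x := ⟨e x, x⟩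
  map_add' x y := by simp
  map_smul' t x := by simp
  map_lie' := by
    intro x y
    have h := congrArg e (hp.ax1 x y)
    simp only [map_sub, LinearEquiv.apply_symm_apply] at h
    simp only [LieAlgebra.SemiDirectSum.lie_eq_mk, plPsi_apply, LinearEquiv.symm_apply_apply]
    congr 1
    rw [add_sub_assoc, h]
    abel

theorem plMain {G N : Type*} [LieRing G] [LieAlgebra ℂ G] [LieRing N] [LieAlgebra ℂ N]
    [FiniteDimensional ℂ G] [LieAlgebra.IsSimple ℂ G]
    (e : G ≃ₗ[ℂ] N) (p : G →ₗ[ℂ] G →ₗ[ℂ] G) (hp : IsPostLieStruct e p) :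
    Nonempty (N ≃ₗ⁅ℂ⁆ G) := by
  have : FiniteDimensional ℂ N := e.finiteDimensional
  let ψ := plPsi e p hp
  let H := LieAlgebra.SemiDirectSum N G ψ
  have : FiniteDimensional ℂ H := (LieAlgebra.SemiDirectSum.toProdl ψ).symm.finiteDimensional
  let ι : G →ₗ⁅ℂ⁆ H := LieAlgebra.SemiDirectSum.inr ψ
  let ρ : G →ₗ⁅ℂ⁆ H := plRho e p hp
  let j : N →ₗ⁅ℂ⁆ H := LieAlgebra.SemiDirectSum.inl ψ
  have hj : ∀ x, j (e x) = ρ x - ι x := by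
    intro x
    change (⟨e x, 0⟩ : LieAlgebra.SemiDirectSum N G ψ) = ⟨e x - 0, x - x⟩
    simp
  let I : LieIdeal ℂ H := (LieAlgebra.SemiDirectSum.projr ψ).ker
  have hjI : ∀ a, j a ∈ I := fun a => LieHom.mem_ker.2 rfl
  have hIj : ∀ z ∈ I, ∃ a, j a = z := by
    rintro ⟨a, b⟩ hz
    have hb : b = 0 := LieHom.mem_ker.1 hz
    subst hb
    exact ⟨a, rfl⟩
  by_cases hI : LieAlgebra.IsSolvable I
  · exfalso
    obtain ⟨hQ⟩ := plRatLie H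
    let τ : G →ₗ[ℂ] I := ((j : N →ₗ[ℂ] H) ∘ₗ e.toLinearMap).codRestrict I.toSubmodule
      (fun x => hjI (e x))
    have hτ : ∀ x, (τ x : H) = j (e x) := fun x => rfl
    have hbij : Function.Bijective τ := by
      constructor
      · intro x y hxy
        have h := congrArg Subtype.val hxy
        rw [hτ, hτ] at h
        exact e.injective (LieAlgebra.SemiDirectSum.inl_injective ψ h)
      · rintro ⟨z, hz⟩
        obtain ⟨a, rfl⟩ := hIj z hz
        refine ⟨e.symm a, Subtype.ext ?_⟩
        rw [hτ, LinearEquiv.apply_symm_apply]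
    exact plSolv ι ρ I (LinearEquiv.ofBijective τ hbij) (fun x => (hτ x).trans (hj x))
  · obtain ⟨L, _, _, q, hL, hq⟩ := plSplit I hI
    have hsurj : Function.Surjective (q.comp j) := by
      intro y
      obtain ⟨x, hx, rfl⟩ := hq y
      obtain ⟨a, rfl⟩ := hIj x hx
      exact ⟨a, rfl⟩
    obtain ⟨y, hy⟩ := exists_ne (0 : L)
    obtain ⟨a, rfl⟩ := hsurj y
    obtain ⟨x, rfl⟩ := e.surjective a
    rw [LieHom.comp_apply, hj, map_sub] at hy
    by_cases h1 : q.comp ρ x = 0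
    · have h2 : q.comp ι x ≠ 0 := by
        intro h2
        rw [LieHom.comp_apply] at h1 h2
        exact hy (by rw [h1, h2, sub_zero])
      exact plIso e (q.comp j) hsurj (q.comp ι) (plInj _ x h2)
    · exact plIso e (q.comp j) hsurj (q.comp ρ) (plInj _ x h1)

end PostLieHelpers

/-- If `(g, n)` is a pair of finite-dimensional complex Lie algebras on the same underlying
vector space with `g` simple, and `(g, n)` admits a post-Lie algebra structure, then `n` is
isomorphic to `g`. -/
theorem statement0 (G N : Type*) [LieRing G] [LieAlgebra ℂ G] [LieRing N] [LieAlgebra ℂ N]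
    [FiniteDimensional ℂ G] [LieAlgebra.IsSimple ℂ G]
    (e : G ≃ₗ[ℂ] N) (p : G →ₗ[ℂ] G →ₗ[ℂ] G) (hp : IsPostLieStruct e p) :
    Nonempty (N ≃ₗ⁅ℂ⁆ G) := by
  exact plMain e p hp
end

section
/- Let g = (V,[,]) and n = (V,{,}) be two finite-dimensional complex Lie algebra structures on the same vector space V, where n is semisimple, and let φ be a linear endomorphism of V. Then the bilinear product defined by x·y = {φ(x),y} is a post-Lie algebra structure on the pair (g,n) if and only if for all x,y in V: {φ(x),y} + {x,φ(y)} = [x,y] − {x,y}, and φ([x,y]) = {φ(x),φ(y)}. -/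
/-- For `n` semisimple and `φ` a linear endomorphism of the common underlying space,
the product `x · y = {φ(x), y}` is a post-Lie algebra structure on `(g, n)` if and only if
`{φ(x), y} + {x, φ(y)} = [x,y] - {x,y}` and `φ([x,y]) = {φ(x), φ(y)}` for all `x, y`. -/
theorem statement6 (G N : Type*) [LieRing G] [LieAlgebra ℂ G] [LieRing N] [LieAlgebra ℂ N]
    [FiniteDimensional ℂ N] [LieAlgebra.IsSemisimple ℂ N]
    (e : G ≃ₗ[ℂ] N) (φ : G →ₗ[ℂ] G)
    (p : G →ₗ[ℂ] G →ₗ[ℂ] G)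
    (hpdef : ∀ x y : G, p x y = e.symm ⁅e (φ x), e y⁆) :
    IsPostLieStruct e p ↔
      ((∀ x y : G, e.symm ⁅e (φ x), e y⁆ + e.symm ⁅e x, e (φ y)⁆ = ⁅x, y⁆ - e.symm ⁅e x, e y⁆) ∧
       (∀ x y : G, φ ⁅x, y⁆ = e.symm ⁅e (φ x), e (φ y)⁆)) := by
  have key : ∀ a b : N, (∀ z : N, ⁅a, z⁆ = ⁅b, z⁆) → a = b := by
    intro a b h
    have hc : a - b ∈ LieAlgebra.center ℂ N := by
      rw [LieModule.mem_maxTrivSubmodule]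
      intro z
      rw [← lie_skew, sub_lie, h z, sub_self, neg_zero]
    rw [LieAlgebra.center_eq_bot] at hc
    exact sub_eq_zero.mp ((LieSubmodule.mem_bot _).mp hc)
  have hskew : ∀ x y : G, e.symm ⁅e (φ x), e y⁆ + e.symm ⁅e x, e (φ y)⁆ = p x y - p y x := by
    intro x y
    rw [hpdef, hpdef, ← lie_skew (e x) (e (φ y)), map_neg, sub_eq_add_neg]
  constructor
  · intro h
    refine ⟨fun x y => (hskew x y).trans (h.ax1 x y), fun x y => ?_⟩
    apply e.injective
    rw [e.apply_symm_apply]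
    apply key
    intro z
    have h2 := congrArg e (h.ax2 x y (e.symm z))
    simp only [hpdef, map_sub, LinearEquiv.apply_symm_apply] at h2
    rw [h2, lie_lie]
  · rintro ⟨h1, h2⟩
    refine ⟨fun x y => (hskew x y).symm.trans (h1 x y), fun x y z => ?_, fun x y z => ?_⟩
    · simp only [hpdef, h2, LinearEquiv.apply_symm_apply, lie_lie, map_sub]
    · simp only [hpdef, LinearEquiv.apply_symm_apply]
      rw [← map_add, ← leibniz_lie]
end

section
/- Any commutative post-Lie algebra structure on a finite-dimensional semisimple complex Lie algebra g is trivial, i.e., the product satisfies x·y = 0 for all x,y in g. -/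
/-- A commutative post-Lie algebra structure on a Lie algebra `L`, given by a bilinear
product `p`. -/
structure IsCommPostLieStruct {k L : Type*} [CommRing k] [LieRing L] [LieAlgebra k L]
    (p : L →ₗ[k] L →ₗ[k] L) : Prop where
  comm : ∀ x y : L, p x y = p y x
  ax2 : ∀ x y z : L, p ⁅x, y⁆ z = p x (p y z) - p y (p x z)
  ax3 : ∀ x y z : L, p x ⁅y, z⁆ = ⁅p x y, z⁆ + ⁅y, p x z⁆

/-- Any commutative post-Lie algebra structure on a finite-dimensional semisimple complex
Lie algebra is trivial. -/
theorem statement7 (L : Type*) [LieRing L] [LieAlgebra ℂ L] [FiniteDimensional ℂ L]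
    [LieAlgebra.IsSemisimple ℂ L]
    (p : L →ₗ[ℂ] L →ₗ[ℂ] L) (hp : IsCommPostLieStruct p) :
    ∀ x y : L, p x y = 0 := by
  have hskew : ∀ x y z : L,
      killingForm ℂ L (p x y) z = - killingForm ℂ L (p x z) y := by
    intro x y z
    let D : LieDerivation ℂ L L :=
      { toLinearMap := p x
        leibniz' := fun a b => by
          rw [hp.ax3 x a b, ← lie_skew (p x a) b]
          abel }
    obtain ⟨u, hu⟩ := LieDerivation.IsKilling.exists_eq_ad D
    have h : ∀ w, p x w = ⁅u, w⁆ := fun w => by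
      have h0 : D w = p x w := rfl
      rw [← h0, ← hu]
      exact LinearMap.congr_fun (LieDerivation.coe_ad_apply_eq_ad_apply (R := ℂ) u) w
    rw [h, h, ← lie_skew u y, map_neg, LinearMap.neg_apply,
      LieModule.traceForm_apply_lie_apply, LieModule.traceForm_comm]
  intro x y
  have hz : ∀ z, killingForm ℂ L (p x y) z = 0 := by
    intro z
    have h1 := hskew x y z
    have h2 := hskew y x z
    have h3 := hskew z x y
    rw [hp.comm y x, hp.comm y z] at h2
    rw [hp.comm z x] at h3
    have : (2 : ℂ) * killingForm ℂ L (p x y) z = 0 := by linear_combination h1 + h2 - h3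
    simpa using this
  have hk : p x y ∈ LinearMap.ker (killingForm ℂ L) := LinearMap.ext hz
  simpa using hk
end

section
/- Let x·y be a commutative post-Lie algebra structure on a finite-dimensional complex Lie algebra g. Then x·y belongs to the solvable radical rad(g) of g for all x,y in g. -/
/-- Derivations are skew-adjoint with respect to the Killing form. -/
theorem killing_skew_aux (L : Type*) [LieRing L] [LieAlgebra ℂ L] [FiniteDimensional ℂ L]
    (D : Module.End ℂ L) (hD : ∀ y z : L, D ⁅y, z⁆ = ⁅D y, z⁆ + ⁅y, D z⁆) (y z : L) :
    killingForm ℂ L (D y) z = - killingForm ℂ L (D z) y := by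
  have had : ∀ w : L, LieAlgebra.ad ℂ L (D w)
      = D * LieAlgebra.ad ℂ L w - LieAlgebra.ad ℂ L w * D := by
    intro w
    ext v
    simp [hD]
  rw [killingForm_apply_apply, killingForm_apply_apply, had, had]
  change LinearMap.trace ℂ L ((D * LieAlgebra.ad ℂ L y - LieAlgebra.ad ℂ L y * D)
      * LieAlgebra.ad ℂ L z) = - LinearMap.trace ℂ L ((D * LieAlgebra.ad ℂ L z
      - LieAlgebra.ad ℂ L z * D) * LieAlgebra.ad ℂ L y)
  generalize LieAlgebra.ad ℂ L y = a
  generalize LieAlgebra.ad ℂ L z = b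
  simp only [sub_mul, map_sub]
  have h1 : LinearMap.trace ℂ L (a * D * b) = LinearMap.trace ℂ L (D * b * a) := by
    rw [mul_assoc]; exact LinearMap.trace_mul_comm ℂ a (D * b)
  have h2 : LinearMap.trace ℂ L (b * D * a) = LinearMap.trace ℂ L (D * a * b) := by
    rw [mul_assoc]; exact LinearMap.trace_mul_comm ℂ b (D * a)
  rw [h1, h2]; ring

/-- For any commutative post-Lie algebra structure on a finite-dimensional complex Lie
algebra `g`, all products `x · y` lie in the solvable radical of `g`. -/
theorem statement8 (L : Type*) [LieRing L] [LieAlgebra ℂ L] [FiniteDimensional ℂ L]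
    (p : L →ₗ[ℂ] L →ₗ[ℂ] L) (hp : IsCommPostLieStruct p) :
    ∀ x y : L, p x y ∈ LieAlgebra.radical ℂ L := by
  intro x y
  apply LieAlgebra.killingCompl_top_le_radical ℂ L
  rw [LieIdeal.mem_killingCompl]
  intro z _
  rw [LieModule.traceForm_comm]
  have s : ∀ a b c : L, killingForm ℂ L (p a b) c = - killingForm ℂ L (p a c) b :=
    fun a b c => killing_skew_aux L (p a) (hp.ax3 a) b c
  have e1 := s x y z
  have e2 := s z x y
  have e3 := s y z x
  rw [hp.comm z x] at e2
  rw [hp.comm z y] at e2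
  rw [hp.comm y x] at e3
  change killingForm ℂ L (p x y) z = 0
  linear_combination (1/2 : ℂ) * (e1 - e2 + e3)
end

section
/- Let g be a finite-dimensional complex Lie algebra containing an abelian ideal a and a semisimple subalgebra s such that g = a ⊕ s as vector spaces (a ∩ s = 0 and a + s = g). Let d : a → a be a linear map which is an s-morphism, i.e., d([x,b]) = [x,d(b)] for all x ∈ s and b ∈ a, and let D : g → g be the linear map with D(b + x) = d(b) for b ∈ a, x ∈ s. If D is an inner derivation of g, i.e., D = ad_g(z) for some z ∈ g, then D = 0 and hence d = 0. -/
/-- Let `g = a ⋊ s` with `a` an abelian ideal and `s` a semisimple subalgebra.  If the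
linear map `D` determined by an `s`-morphism `d : a → a` (via `D(b + x) = d(b)`) is an
inner derivation of `g`, then `D = 0` and hence `d = 0`. -/
theorem statement11 (g : Type*) [LieRing g] [LieAlgebra ℂ g] [FiniteDimensional ℂ g]
    (a : LieIdeal ℂ g) (habel : ∀ x ∈ a, ∀ y ∈ a, ⁅x, y⁆ = (0 : g))
    (s : LieSubalgebra ℂ g) [LieAlgebra.IsSemisimple ℂ s]
    (hcompl : IsCompl a.toSubmodule s.toSubmodule)
    (d : a →ₗ[ℂ] a)
    (hd : ∀ (x : s) (b : a), (d ⟨⁅(x : g), (b : g)⁆, a.lie_mem b.2⟩ : g) = ⁅(x : g), (d b : g)⁆)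
    (D : g →ₗ[ℂ] g)
    (hD : ∀ (b : a) (x : s), D ((b : g) + (x : g)) = (d b : g))
    (hinner : ∃ z : g, ∀ u : g, D u = ⁅z, u⁆) :
    D = 0 ∧ d = 0 := by
  obtain ⟨z, hz⟩ := hinner
  have hdec : ∀ u : g, ∃ b ∈ a, ∃ x ∈ s, b + x = u := by
    intro u
    have hu : u ∈ a.toSubmodule ⊔ s.toSubmodule := by
      rw [hcompl.sup_eq_top]; trivial
    obtain ⟨b, hb, x, hx, h⟩ := Submodule.mem_sup.1 hu
    exact ⟨b, hb, x, hx, h⟩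
  obtain ⟨b₀, hb₀, x₀, hx₀, rfl⟩ := hdec z
  -- `D` vanishes on `s`
  have hDs : ∀ x ∈ s, D x = 0 := by
    intro x hx
    have := hD 0 ⟨x, hx⟩
    simpa using this
  -- the `s`-component of `z` is central in `s`, hence zero
  have hcen : ∀ x ∈ s, ⁅x₀, x⁆ = 0 := by
    intro x hx
    have h1 : ⁅b₀, x⁆ + ⁅x₀, x⁆ = 0 := by
      rw [← add_lie, ← hz, hDs x hx]
    have h2 : ⁅b₀, x⁆ ∈ a := lie_mem_left ℂ g a b₀ x hb₀
    have h3 : ⁅x₀, x⁆ ∈ a := by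
      rw [eq_neg_of_add_eq_zero_right h1]
      exact neg_mem h2
    exact Submodule.disjoint_def.1 hcompl.disjoint _ h3 (s.lie_mem hx₀ hx)
  have hx0 : x₀ = 0 := by
    have hm : (⟨x₀, hx₀⟩ : s) ∈ LieAlgebra.center ℂ s := by
      rw [LieModule.mem_maxTrivSubmodule]
      intro x
      apply Subtype.ext
      have := hcen x x.2
      rw [← lie_skew, neg_eq_zero] at this
      simpa using this
    rw [LieAlgebra.center_eq_bot] at hm
    exact congrArg Subtype.val ((LieSubmodule.mem_bot _).1 hm)
  subst hx0
  have hD0 : D = 0 := by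
    ext u
    obtain ⟨b, hb, x, hx, rfl⟩ := hdec u
    rw [map_add, hDs x hx, hz, add_zero, add_zero, habel b₀ hb₀ b hb]
    simp
  refine ⟨hD0, ?_⟩
  ext b
  have := hD b 0
  rw [hD0] at this
  simpa using this.symm
end

section
/- Let g be a finite-dimensional complex Lie algebra whose solvable radical a is abelian, and let s be a semisimple subalgebra with g = a ⊕ s as vector spaces. For each linear s-morphism d : a → a (i.e., d([x,b]) = [x,d(b)] for all x ∈ s, b ∈ a), the linear map D_d : g → g defined by D_d(b + x) = d(b) for b ∈ a, x ∈ s is a derivation of g, and the assignment d ↦ D_d + Inn(g) gives a linear bijection from the space End_s(a) of s-morphisms of a onto the quotient Der(g)/Inn(g) of the derivations of g by the inner derivations. -/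
section WhiteheadLemma
open LieModule LieAlgebra Module

section Whitehead
variable {K L : Type*} [Field K] [CharZero K] [LieRing L] [LieAlgebra K L] [FiniteDimensional K L]
  [IsKilling K L]

lemma wh_perfect : derivedSeries K L 1 = ⊤ := by
  set J := derivedSeries K L 1 with hJ
  have h := LieIdeal.isCompl_killingCompl (K := K) J
  have hab : IsLieAbelian (LieIdeal.killingCompl K L J) := by
    constructor
    rintro ⟨x, hx⟩ ⟨y, hy⟩
    have h1 : ⁅x, y⁆ ∈ J := by
      rw [hJ]
      change ⁅x, y⁆ ∈ (⁅(⊤ : LieIdeal K L), (⊤ : LieIdeal K L)⁆ : LieIdeal K L)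
      exact LieSubmodule.lie_mem_lie (LieSubmodule.mem_top x) (LieSubmodule.mem_top y)
    have h2 : ⁅x, y⁆ ∈ LieIdeal.killingCompl K L J := LieSubmodule.lie_mem _ hy
    have : ⁅x, y⁆ ∈ (⊥ : LieIdeal K L) := by
      rw [← h.inf_eq_bot]; exact ⟨h1, h2⟩
    ext
    simpa using this
  have := IsKilling.ideal_eq_bot_of_isLieAbelian (R := K) (LieIdeal.killingCompl K L J)
  have h2 := h.sup_eq_top
  rwa [this, sup_bot_eq] at h2

lemma wh_dual {V M ι : Type*} [Fintype ι] [AddCommGroup V] [Module K V]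
    [AddCommGroup M] [Module K M]
    (β : LinearMap.BilinForm K V) (T : V →ₗ[K] V)
    (hT : ∀ u v, β (T u) v = - β u (T v)) (e f : ι → V)
    (he : ∀ v, v = ∑ j, β v (f j) • e j) (hf : ∀ v, v = ∑ j, β (e j) v • f j)
    (Φ : V →ₗ[K] V →ₗ[K] M) :
    ∑ i, (Φ (T (e i)) (f i) + Φ (e i) (T (f i))) = 0 := by
  rw [Finset.sum_add_distrib]
  have h1 : ∑ i, Φ (T (e i)) (f i) = ∑ i, ∑ j, β (T (e i)) (f j) • Φ (e j) (f i) := by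
    refine Finset.sum_congr rfl fun i _ => ?_
    conv_lhs => rw [he (T (e i))]
    simp
  have h2 : ∑ i, Φ (e i) (T (f i)) = ∑ i, ∑ j, β (e j) (T (f i)) • Φ (e i) (f j) := by
    refine Finset.sum_congr rfl fun i _ => ?_
    conv_lhs => rw [hf (T (f i))]
    simp
  rw [h1, h2, Finset.sum_comm, ← Finset.sum_add_distrib]
  refine Finset.sum_eq_zero fun i _ => ?_
  rw [← Finset.sum_add_distrib]
  refine Finset.sum_eq_zero fun j _ => ?_
  rw [hT, neg_smul, neg_add_cancel]

variable {M : Type*} [AddCommGroup M] [Module K M] [LieRingModule L M]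
  [LieModule K L M] [FiniteDimensional K M]

lemma wh_casimir (hB : traceForm K L M ≠ 0) :
    ∃ (n : ℕ) (e f : Fin n → L),
      (∀ (x : L) (Φ : L →ₗ[K] L →ₗ[K] M),
        ∑ i, (Φ ⁅x, e i⁆ (f i) + Φ (e i) ⁅x, f i⁆) = 0) ∧
      ∑ i, traceForm K L M (e i) (f i) ≠ 0 := by
  classical
  set B := traceForm K L M with hBdef
  have hinv : B.lieInvariant L := traceForm_lieInvariant K L M
  let Kr : LieIdeal K L := InvariantForm.orthogonal B hinv ⊤
  have hKr : ∀ y, y ∈ Kr ↔ ∀ x, B x y = 0 := fun y => by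
    simp [Kr, InvariantForm.mem_orthogonal]
  let I := LieIdeal.killingCompl K L Kr
  have hc : IsCompl Kr I := LieIdeal.isCompl_killingCompl (K := K) Kr
  let β : LinearMap.BilinForm K I := B.restrict I.toSubmodule
  have hβ : ∀ u v : I, β u v = B u v := fun _ _ => rfl
  have hsym : β.IsSymm := ⟨fun u v => traceForm_comm K L M u v⟩
  have hnd0 : ∀ u : I, (∀ v, β u v = 0) → u = 0 := by
    intro u hu
    have : (u : L) ∈ Kr := by
      rw [hKr]
      intro x
      have hx : x ∈ Kr ⊔ I := by rw [hc.sup_eq_top]; trivial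
      obtain ⟨k, hk, i, hi, rfl⟩ := (LieSubmodule.mem_sup _ _ _).1 hx
      have h1 : B k u = 0 := by
        rw [hBdef, traceForm_comm]; exact (hKr k).1 hk u
      have h2 : B i u = 0 := by
        rw [hBdef, traceForm_comm]; exact hu ⟨i, hi⟩
      simp [h1, h2]
    have h0 : (u : L) ∈ (⊥ : LieIdeal K L) := by
      rw [← hc.inf_eq_bot]; exact ⟨this, u.2⟩
    ext
    simpa using h0
  have hnd : β.Nondegenerate :=
    ⟨hnd0, fun u hu => hnd0 u fun v => by rw [hsym.eq]; exact hu v⟩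
  let b := finBasis K I
  let b' := β.dualBasis hnd b
  refine ⟨_, fun i => (b i : L), fun i => (b' i : L), ?_, ?_⟩
  · intro x Φ
    have := wh_dual (M := M) β (toEnd K L I x) (fun u v => hinv x u v) b b'
      (fun v => by
        conv_lhs => rw [← b.sum_repr v]
        refine Finset.sum_congr rfl fun j _ => ?_
        congr 1
        have := LinearMap.BilinForm.dualBasis_repr_apply hnd b' v j
        rw [LinearMap.BilinForm.dualBasis_dualBasis hnd hsym] at this
        exact this)
      (fun v => by
        conv_lhs => rw [← b'.sum_repr v]
        refine Finset.sum_congr rfl fun j _ => ?_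
        congr 1
        rw [hsym.eq]
        exact LinearMap.BilinForm.dualBasis_repr_apply hnd b v j)
      (Φ.compl₁₂ I.toSubmodule.subtype I.toSubmodule.subtype)
    simpa using! this
  · have : ∑ i, B (b i : L) (b' i : L) = finrank K I := by
      have h1 : ∀ i, B (b i : L) (b' i : L) = 1 := fun i => by
        have := LinearMap.BilinForm.apply_dualBasis_right hnd hsym b i i
        rw [if_pos rfl] at this
        exact this
      simp [h1]
    rw [this]
    intro h0
    have h0 : finrank K I = 0 := by exact_mod_cast h0
    have hI : I = ⊥ := by
      rw [← LieSubmodule.toSubmodule_eq_bot]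
      exact Submodule.finrank_eq_zero.1 h0
    have hK : Kr = ⊤ := by
      have := hc.sup_eq_top
      rwa [hI, sup_bot_eq] at this
    apply hB
    ext x y
    exact (hKr y).1 (by rw [hK]; trivial) x

lemma wh_trivial (hB : traceForm K L M = 0) (c : L →ₗ[K] M)
    (hc : ∀ x y, c ⁅x, y⁆ = ⁅x, c y⁆ - ⁅y, c x⁆) : c = 0 := by
  have h1 := isNilpotent_derivedSeries_of_traceForm_eq_zero hB
  have hp : derivedSeries K L 1 = ⊤ := wh_perfect
  have htt : (⁅(⊤ : LieIdeal K L), (⊤ : LieIdeal K L)⁆ : LieIdeal K L) = ⊤ := hp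
  rw [hp] at h1
  have hN : LieModule.IsNilpotent L M := by
    rw [isNilpotent_iff_forall' (R := K)] at h1 ⊢
    exact fun x => h1 ⟨x, trivial⟩
  obtain ⟨k, hk⟩ := IsNilpotent.nilpotent K L M
  have hst : ∀ k, lowerCentralSeries K L M 1 ≤ lowerCentralSeries K L M (k+1) := by
    intro k
    induction k with
    | zero => exact le_rfl
    | succ k ih =>
      have h12 : lowerCentralSeries K L M 1 ≤ lowerCentralSeries K L M 2 := by
        have e1 : lowerCentralSeries K L M 1 = ⁅(⊤ : LieIdeal K L), (⊤ : LieSubmodule K L M)⁆ := rfl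
        have e2 : lowerCentralSeries K L M 2 =
          ⁅(⊤ : LieIdeal K L), ⁅(⊤ : LieIdeal K L), (⊤ : LieSubmodule K L M)⁆⁆ := rfl
        rw [e2, e1]
        conv_lhs => rw [← htt]
        rw [LieSubmodule.lieIdeal_oper_eq_span, LieSubmodule.lieSpan_le]
        rintro _ ⟨⟨x, hx⟩, m, rfl⟩
        change ⁅x, (m : M)⁆ ∈ (⁅(⊤ : LieIdeal K L), ⁅(⊤ : LieIdeal K L), (⊤ : LieSubmodule K L M)⁆⁆ :
          LieSubmodule K L M)
        rw [← LieSubmodule.mem_toSubmodule, LieSubmodule.lieIdeal_oper_eq_linear_span'] at hx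
        have hm : ∀ (y : L), ⁅y, (m : M)⁆ ∈ (⁅(⊤ : LieIdeal K L), (⊤ : LieSubmodule K L M)⁆ :
            LieSubmodule K L M) := fun y =>
          LieSubmodule.lie_mem_lie (LieSubmodule.mem_top y) (LieSubmodule.mem_top _)
        induction hx using Submodule.span_induction with
        | mem x h =>
          obtain ⟨y, _, z, _, rfl⟩ := h
          rw [lie_lie]
          exact sub_mem (LieSubmodule.lie_mem_lie (LieSubmodule.mem_top y) (hm z))
            (LieSubmodule.lie_mem_lie (LieSubmodule.mem_top z) (hm y))
        | zero => rw [zero_lie]; exact zero_mem _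
        | add x y _ _ h1 h2 => rw [add_lie]; exact add_mem h1 h2
        | smul t x _ h => rw [smul_lie]; exact SMulMemClass.smul_mem t h
      refine h12.trans ?_
      rw [lowerCentralSeries_succ K L M (k+1), lowerCentralSeries_succ K L M 1]
      exact LieSubmodule.mono_lie_right _ ih
  have hz : ∀ (x : L) (m : M), ⁅x, m⁆ = 0 := by
    intro x m
    have : ⁅x, m⁆ ∈ lowerCentralSeries K L M 1 :=
      LieSubmodule.lie_mem_lie (LieSubmodule.mem_top x) (LieSubmodule.mem_top m)
    have := antitone_lowerCentralSeries K L M (Nat.le_succ k) (hst k this)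
    rw [hk] at this
    simpa using this
  ext x
  have hx : x ∈ (⁅(⊤ : LieIdeal K L), (⊤ : LieIdeal K L)⁆ : LieIdeal K L) := by rw [htt]; trivial
  rw [← LieSubmodule.mem_toSubmodule, LieSubmodule.lieIdeal_oper_eq_linear_span'] at hx
  induction hx using Submodule.span_induction with
  | mem x h =>
    obtain ⟨y, _, z, _, rfl⟩ := h
    simp [hc, hz]
  | zero => simp
  | add x y _ _ h1 h2 => simp [h1, h2]
  | smul t x _ h => simp [h]

end Whitehead

theorem wh_whitehead {K L : Type*} [Field K] [CharZero K] [LieRing L] [LieAlgebra K L]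
    [FiniteDimensional K L] [IsKilling K L] (n : ℕ) :
    ∀ (M : Type*) [AddCommGroup M] [Module K M] [LieRingModule L M]
      [LieModule K L M] [FiniteDimensional K M], finrank K M = n →
      ∀ c : L →ₗ[K] M, (∀ x y, c ⁅x, y⁆ = ⁅x, c y⁆ - ⁅y, c x⁆) → ∃ m : M, ∀ x, c x = ⁅x, m⁆ := by
  induction n using Nat.strong_induction_on with
  | _ n ih =>
  intro M _ _ _ _ _ hn c hc
  by_cases hB : traceForm K L M = 0
  · exact ⟨0, fun x => by simp [wh_trivial hB c hc]⟩
  obtain ⟨r, e, f, hinv, htr⟩ := wh_casimir hB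
  let C : M →ₗ[K] M := ∑ i, toEnd K L M (e i) ∘ₗ toEnd K L M (f i)
  have hC : ∀ m, C m = ∑ i, ⁅e i, ⁅f i, m⁆⁆ := fun m => by simp [C]
  have hCtr : LinearMap.trace K M C ≠ 0 := by
    simpa [C, traceForm_apply_apply] using htr
  have hcomm : ∀ (x : L) (m : M), C ⁅x, m⁆ = ⁅x, C m⁆ := by
    intro x m
    have h := hinv x (LinearMap.mk₂ K (fun y z => ⁅y, ⁅z, m⁆⁆) (by simp) (by simp) (by simp)
      (by simp))
    rw [hC, hC, lie_sum, eq_comm, ← sub_eq_zero, ← Finset.sum_sub_distrib, ← h]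
    refine Finset.sum_congr rfl fun i _ => ?_
    simp only [LinearMap.mk₂_apply, lie_lie]
    simp only [lie_sub]
    abel
  have hkey : ∀ x, ⁅x, ∑ i, ⁅e i, c (f i)⁆⁆ = C (c x) := by
    intro x
    have h := hinv x (LinearMap.mk₂ K (fun y z => ⁅y, c z⁆) (by simp) (by simp) (by simp)
      (by simp))
    rw [hC, lie_sum, ← sub_eq_zero, ← Finset.sum_sub_distrib, ← h]
    refine Finset.sum_congr rfl fun i _ => ?_
    simp only [LinearMap.mk₂_apply, lie_lie, hc, lie_sub]
    abel
  let N : LieSubmodule K L M :=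
    { LinearMap.ker C with
      lie_mem := fun {x m} hm => by
        have hm : C m = 0 := hm
        change C ⁅x, m⁆ = 0
        rw [hcomm, hm, lie_zero] }
  have hN : ∀ m, m ∈ N ↔ C m = 0 := fun m => Iff.rfl
  by_cases hbot : N.toSubmodule = ⊥
  · have hinj : Function.Injective C := LinearMap.ker_eq_bot.1 hbot
    obtain ⟨m, hm⟩ := LinearMap.surjective_of_injective hinj (∑ i, ⁅e i, c (f i)⁆)
    refine ⟨m, fun x => hinj ?_⟩
    rw [hcomm, hm, hkey]
  · have htop : N.toSubmodule ≠ ⊤ := by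
      intro h
      have : C = 0 := LinearMap.ker_eq_top.1 h
      exact hCtr (by rw [this, map_zero])
    have hlt : finrank K N < n := hn ▸ Submodule.finrank_lt htop
    have hpos : 0 < finrank K N := by
      rw [Nat.pos_iff_ne_zero]
      exact fun h => hbot (Submodule.finrank_eq_zero.1 h)
    have hsum : finrank K (M ⧸ N) + finrank K N = n :=
      hn ▸ Submodule.finrank_quotient_add_finrank N.toSubmodule
    have : FiniteDimensional K (M ⧸ N) :=
      inferInstanceAs (FiniteDimensional K (M ⧸ N.toSubmodule))
    obtain ⟨mb, hmb⟩ := ih _ (by omega) (M ⧸ N) rfl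
      ((LieSubmodule.Quotient.mk' N : M →ₗ[K] M ⧸ N) ∘ₗ c) (by
        intro x y
        change LieSubmodule.Quotient.mk' N (c ⁅x, y⁆) =
          ⁅x, LieSubmodule.Quotient.mk' N (c y)⁆ - ⁅y, LieSubmodule.Quotient.mk' N (c x)⁆
        rw [hc, map_sub, LieModuleHom.map_lie, LieModuleHom.map_lie])
    obtain ⟨m1, rfl⟩ := LieSubmodule.Quotient.surjective_mk' N mb
    let c1 : L →ₗ[K] M := c - (toEnd K L M : L →ₗ[K] End K M).flip m1
    have hc1 : ∀ x, c1 x = c x - ⁅x, m1⁆ := fun x => rfl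
    have hc1N : ∀ x, c1 x ∈ N.toSubmodule := by
      intro x
      rw [LieSubmodule.mem_toSubmodule, ← LieSubmodule.Quotient.mk_eq_zero, hc1, map_sub,
        LieModuleHom.map_lie, sub_eq_zero]
      exact hmb x
    obtain ⟨m2, hm2⟩ := ih _ hlt N rfl (c1.codRestrict N.toSubmodule hc1N) (by
      intro x y
      apply Subtype.ext
      change c1 ⁅x, y⁆ = ⁅x, c1 y⁆ - ⁅y, c1 x⁆
      simp only [hc1, hc, lie_sub, lie_lie]
      abel)
    refine ⟨m1 + m2, fun x => ?_⟩
    have h : c1 x = ⁅x, (m2 : M)⁆ := congrArg Subtype.val (hm2 x)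
    rw [hc1] at h
    rw [lie_add, ← h]
    abel

end WhiteheadLemma


/-- Let `g = a ⋊ s` where the solvable radical `a` of `g` is abelian and `s` is a
semisimple subalgebra.  Then the assignment sending an `s`-morphism `d : a → a` to the class
of the derivation `D_d : b + x ↦ d(b)` modulo inner derivations is a bijection from
`End_s(a)` onto the outer derivations `Der(g)/Inn(g)`: each `D_d` is a derivation, `d` is
determined by the class of `D_d`, and every derivation of `g` is of the form `D_d` up to an
inner derivation. -/
theorem statement12 (g : Type*) [LieRing g] [LieAlgebra ℂ g] [FiniteDimensional ℂ g]
    (a : LieIdeal ℂ g) (ha : a = LieAlgebra.radical ℂ g)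
    (habel : ∀ x ∈ a, ∀ y ∈ a, ⁅x, y⁆ = (0 : g))
    (s : LieSubalgebra ℂ g) [LieAlgebra.IsSemisimple ℂ s]
    (hcompl : IsCompl a.toSubmodule s.toSubmodule) :
    -- the map is well defined: `D_d` is a derivation of `g`
    (∀ d : a →ₗ[ℂ] a,
      (∀ (x : s) (b : a), (d ⟨⁅(x : g), (b : g)⁆, a.lie_mem b.2⟩ : g) = ⁅(x : g), (d b : g)⁆) →
      ∀ D : g →ₗ[ℂ] g, (∀ (b : a) (x : s), D ((b : g) + (x : g)) = (d b : g)) →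
        ∀ u v : g, D ⁅u, v⁆ = ⁅D u, v⁆ + ⁅u, D v⁆) ∧
    -- injectivity: two `s`-morphisms whose associated derivations differ by an inner
    -- derivation coincide
    (∀ d d' : a →ₗ[ℂ] a,
      (∀ (x : s) (b : a), (d ⟨⁅(x : g), (b : g)⁆, a.lie_mem b.2⟩ : g) = ⁅(x : g), (d b : g)⁆) →
      (∀ (x : s) (b : a), (d' ⟨⁅(x : g), (b : g)⁆, a.lie_mem b.2⟩ : g) = ⁅(x : g), (d' b : g)⁆) →
      ∀ D D' : g →ₗ[ℂ] g,
        (∀ (b : a) (x : s), D ((b : g) + (x : g)) = (d b : g)) →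
        (∀ (b : a) (x : s), D' ((b : g) + (x : g)) = (d' b : g)) →
        (∃ z : g, ∀ u : g, D u - D' u = ⁅z, u⁆) → d = d') ∧
    -- surjectivity: every derivation of `g` is, modulo an inner derivation, of the form `D_d`
    (∀ D : g →ₗ[ℂ] g, (∀ u v : g, D ⁅u, v⁆ = ⁅D u, v⁆ + ⁅u, D v⁆) →
      ∃ d : a →ₗ[ℂ] a,
        (∀ (x : s) (b : a), (d ⟨⁅(x : g), (b : g)⁆, a.lie_mem b.2⟩ : g) = ⁅(x : g), (d b : g)⁆) ∧
        ∃ z : g, ∀ (b : a) (x : s),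
          D ((b : g) + (x : g)) = (d b : g) + ⁅z, (b : g) + (x : g)⁆) := by
  have hdec : ∀ u : g, ∃ (b : a) (x : s), u = (b : g) + (x : g) := by
    intro u
    have hu : u ∈ a.toSubmodule ⊔ s.toSubmodule := by rw [hcompl.sup_eq_top]; trivial
    obtain ⟨b, hb, x, hx, rfl⟩ := Submodule.mem_sup.1 hu
    exact ⟨⟨b, hb⟩, ⟨x, hx⟩, rfl⟩
  have hdisj : ∀ u : g, u ∈ a → u ∈ s → u = 0 := by
    intro u h1 h2
    have : u ∈ a.toSubmodule ⊓ s.toSubmodule := ⟨h1, h2⟩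
    rw [hcompl.inf_eq_bot] at this
    simpa using this
  have hal : ∀ (u b : g), b ∈ a → ⁅u, b⁆ ∈ a := fun u b hb => a.lie_mem hb
  have har : ∀ (u b : g), b ∈ a → ⁅b, u⁆ ∈ a := fun u b hb => by
    rw [← lie_skew]; exact neg_mem (a.lie_mem hb)
  refine ⟨?_, ?_, ?_⟩
  · intro d hd D hD u v
    have hDa : ∀ b (hb : b ∈ a), D b = d ⟨b, hb⟩ := fun b hb => by
      have := hD ⟨b, hb⟩ 0
      simpa using this
    have hDs : ∀ x ∈ s, D x = 0 := fun x hx => by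
      have := hD 0 ⟨x, hx⟩
      simpa using this
    have hxb : ∀ (x : s) (b : a), D ⁅(x : g), (b : g)⁆ = ⁅(x : g), (d b : g)⁆ := fun x b => by
      rw [hDa _ (hal x b b.2)]; exact hd x b
    obtain ⟨b, x, rfl⟩ := hdec u
    obtain ⟨b', x', rfl⟩ := hdec v
    rw [hD, hD]
    have e1 : D ⁅(b : g), (x' : g)⁆ = ⁅(d b : g), (x' : g)⁆ := by
      rw [← lie_skew, map_neg, hxb, lie_skew]
    have e2 : D ⁅(x : g), (x' : g)⁆ = 0 := hDs _ (s.lie_mem x.2 x'.2)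
    simp only [add_lie, lie_add, map_add, hxb, e1, e2, habel _ b.2 _ b'.2,
      habel _ (d b).2 _ b'.2, habel _ b.2 _ (d b').2, map_zero]
    abel
  · rintro d d' - - D D' hD hD' ⟨z, hz⟩
    obtain ⟨b₀, x₀, rfl⟩ := hdec z
    have hx₀ : x₀ = 0 := by
      have hc : x₀ ∈ LieAlgebra.center ℂ s := by
        rw [LieModule.mem_maxTrivSubmodule]
        intro y
        have h := hz y
        have h1 : D y = 0 := by simpa using hD 0 y
        have h2 : D' y = 0 := by simpa using hD' 0 y
        rw [h1, h2, sub_zero, add_lie] at h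
        have h3 : ⁅(x₀ : g), (y : g)⁆ = 0 := by
          refine hdisj _ ?_ (s.lie_mem x₀.2 y.2)
          rw [← neg_eq_of_add_eq_zero_right h.symm]
          exact neg_mem (har _ _ b₀.2)
        apply Subtype.ext
        change ⁅(y : g), (x₀ : g)⁆ = 0
        rw [← lie_skew, h3, neg_zero]
      rw [LieAlgebra.center_eq_bot] at hc
      simpa using hc
    ext b
    have h := hz b
    have h1 : D b = d b := by simpa using hD b 0
    have h2 : D' b = d' b := by simpa using hD' b 0
    rw [h1, h2, hx₀, add_lie, habel _ b₀.2 _ b.2] at h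
    simpa [sub_eq_zero] using h
  · intro D hD
    -- the projection onto `s`
    let q : g →ₗ[ℂ] s := s.toSubmodule.projectionOnto a.toSubmodule hcompl.symm
    have hqs : ∀ x : s, q x = x := fun x =>
      Submodule.projectionOnto_apply_left hcompl.symm x
    have hqa : ∀ b ∈ a, q b = 0 := fun b hb =>
      Submodule.projectionOnto_apply_right hcompl.symm ⟨b, hb⟩
    have hqsub : ∀ u : g, u - (q u : g) ∈ a := by
      intro u
      obtain ⟨b, x, rfl⟩ := hdec u
      rw [map_add, hqs, hqa _ b.2]
      simp
    have hq0 : ∀ u, q u = 0 → u ∈ a := fun u hu => by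
      have := hqsub u
      rw [hu] at this
      simpa using this
    have hqlie : ∀ u v, q ⁅u, v⁆ = ⁅q u, q v⁆ := by
      intro u v
      obtain ⟨b, x, rfl⟩ := hdec u
      obtain ⟨b', x', rfl⟩ := hdec v
      have e : q ⁅(x : g), (x' : g)⁆ = ⁅x, x'⁆ := hqs ⁅x, x'⁆
      simp only [add_lie, lie_add, map_add, hqs, hqa _ b.2, hqa _ b'.2, e,
        hqa _ (har x' _ b.2), hqa _ (hal x _ b'.2), habel _ b.2 _ b'.2]
      simp
    -- `D` preserves `a`
    have hDa : ∀ b ∈ a, D b ∈ a := by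
      let J : LieIdeal ℂ s :=
        { a.toSubmodule.map (q ∘ₗ D) with
          lie_mem := by
            rintro x _ ⟨b, hb, rfl⟩
            refine ⟨⁅(x : g), b⁆, hal _ _ hb, ?_⟩
            change q (D ⁅(x : g), b⁆) = ⁅x, q (D b)⁆
            rw [hD, map_add, hqlie, hqlie, hqa _ hb, hqs]
            simp }
      have hJ : IsLieAbelian J := by
        constructor
        rintro ⟨_, b, hb, rfl⟩ ⟨_, b', hb', rfl⟩
        apply Subtype.ext
        change ⁅q (D b), q (D b')⁆ = 0
        have h := hD b b'
        rw [habel _ hb _ hb', map_zero] at h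
        have h2 := congrArg q (congrArg D h)
        rw [map_zero, map_zero, map_add, hD, hD, map_add, map_add, map_add, hqlie, hqlie, hqlie,
          hqa _ hb, hqa _ hb'] at h2
        simp only [lie_zero, zero_lie, zero_add, add_zero] at h2
        have h3 : (2 : ℂ) • ⁅q (D b), q (D b')⁆ = 0 := by rw [two_smul]; exact h2.symm
        exact (smul_eq_zero.1 h3).resolve_left two_ne_zero
      have hJ0 : J = ⊥ := (LieAlgebra.hasTrivialRadical_iff_no_abelian_ideals ℂ s).1
        inferInstance J hJ
      intro b hb
      apply hq0
      have : q (D b) ∈ J := ⟨b, hb, rfl⟩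
      rw [hJ0] at this
      simpa using this
    -- the `s`-part of `D` is inner
    let E : LieDerivation ℂ s s :=
      { toLinearMap := q ∘ₗ D ∘ₗ s.toSubmodule.subtype
        leibniz' := by
          intro x y
          change q (D ⁅(x : g), (y : g)⁆) = ⁅x, q (D y)⁆ - ⁅y, q (D x)⁆
          rw [hD, map_add, hqlie, hqlie, hqs, hqs, ← lie_skew y]
          abel }
    obtain ⟨z₀, hz₀⟩ := LieDerivation.IsKilling.exists_eq_ad E
    have hz₀' : ∀ x : s, q (D x) = ⁅z₀, x⁆ := fun x => by
      have := congrArg (fun F : LieDerivation ℂ s s => F x) hz₀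
      simp only [LieDerivation.ad_apply_apply] at this
      exact this.symm
    -- the `a`-part of `D` is a cocycle
    let D₁ : g →ₗ[ℂ] g := D - LieAlgebra.ad ℂ g z₀
    have hD₁ : ∀ u, D₁ u = D u - ⁅(z₀ : g), u⁆ := fun u => rfl
    have hD₁d : ∀ u v : g, D₁ ⁅u, v⁆ = ⁅D₁ u, v⁆ + ⁅u, D₁ v⁆ := by
      intro u v
      simp only [hD₁, hD, sub_lie, lie_sub, lie_lie]
      abel
    have hD₁s : ∀ x : s, D₁ x ∈ a := fun x => by
      apply hq0
      rw [hD₁, map_sub, hz₀', hqlie, hqs, hqs, sub_self]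
    let c : s →ₗ[ℂ] a :=
      (D₁ ∘ₗ s.toSubmodule.subtype).codRestrict a.toSubmodule hD₁s
    obtain ⟨m, hm⟩ := wh_whitehead (K := ℂ) (L := s) _ a rfl c (by
      intro x y
      apply Subtype.ext
      change D₁ ⁅(x : g), (y : g)⁆ = ⁅(x : g), D₁ y⁆ - ⁅(y : g), D₁ x⁆
      rw [hD₁d, ← lie_skew (y : g)]
      abel)
    have hm' : ∀ x : s, D₁ x = ⁅(x : g), (m : g)⁆ := fun x => congrArg Subtype.val (hm x)
    let D₂ : g →ₗ[ℂ] g := D₁ + LieAlgebra.ad ℂ g m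
    have hD₂ : ∀ u, D₂ u = D₁ u + ⁅(m : g), u⁆ := fun u => rfl
    have hD₂d : ∀ u v : g, D₂ ⁅u, v⁆ = ⁅D₂ u, v⁆ + ⁅u, D₂ v⁆ := by
      intro u v
      simp only [hD₂, hD₁d, add_lie, lie_add, lie_lie]
      abel
    have hD₂s : ∀ x : s, D₂ x = 0 := fun x => by
      rw [hD₂, hm', ← lie_skew, neg_add_cancel]
    have hD₂a : ∀ b : a, D₂ b ∈ a := fun b => by
      rw [hD₂, hD₁]
      exact add_mem (sub_mem (hDa _ b.2) (hal _ _ b.2)) (hal _ _ b.2)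
    refine ⟨(D₂ ∘ₗ a.toSubmodule.subtype).codRestrict a.toSubmodule hD₂a, ?_, z₀ - m, ?_⟩
    · intro x b
      change D₂ ⁅(x : g), (b : g)⁆ = ⁅(x : g), D₂ b⁆
      rw [hD₂d, hD₂s, zero_lie, zero_add]
    · intro b x
      change D (b + x) = D₂ b + ⁅(z₀ : g) - m, (b : g) + x⁆
      have h : D₂ (b + x) = D₂ b := by rw [map_add, hD₂s, add_zero]
      rw [← h, hD₂, hD₁, sub_lie]
      abel
end

section
/- Let g be a finite-dimensional perfect complex Lie algebra whose solvable radical a is abelian, with a semisimple subalgebra s such that g = a ⊕ s as vector spaces. Assume that a, as an s-module (with action x·b = [x,b] for x ∈ s, b ∈ a), decomposes into a direct sum of irreducible s-submodules which are pairwise nonisomorphic. Then any commutative post-Lie algebra structure on g is trivial. -/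
/-- The action of `g` on an ideal `a`, viewed as a map into the subtype `a`. -/
def LieIdeal.bracketAction {g : Type*} [LieRing g] [LieAlgebra ℂ g] (a : LieIdeal ℂ g)
    (x : g) (w : a) : a :=
  ⟨⁅x, (w : g)⁆, a.lie_mem w.2⟩

open LinearMap in
/-- Derivations are skew-adjoint for the Killing form. -/
lemma CPA.killing_skew {g : Type*} [LieRing g] [LieAlgebra ℂ g] [FiniteDimensional ℂ g]
    (D : g →ₗ[ℂ] g) (hD : ∀ y z, D ⁅y, z⁆ = ⁅D y, z⁆ + ⁅y, D z⁆) (y z : g) :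
    killingForm ℂ g (D y) z = - killingForm ℂ g y (D z) := by
  have key : ∀ y, LieAlgebra.ad ℂ g (D y) =
      D ∘ₗ LieAlgebra.ad ℂ g y - LieAlgebra.ad ℂ g y ∘ₗ D := by
    intro y
    ext z
    simp [hD]
  rw [LieModule.traceForm_apply_apply, LieModule.traceForm_apply_apply]
  change trace ℂ g (LieAlgebra.ad ℂ g (D y) ∘ₗ LieAlgebra.ad ℂ g z) =
    - trace ℂ g (LieAlgebra.ad ℂ g y ∘ₗ LieAlgebra.ad ℂ g (D z))
  rw [key, key, LinearMap.sub_comp, LinearMap.comp_sub, map_sub, map_sub, LinearMap.comp_assoc,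
    LinearMap.trace_comp_comm', LinearMap.comp_assoc, LinearMap.comp_assoc]
  ring

/-- The product lands in the radical. -/
lemma CPA.mem_radical {g : Type*} [LieRing g] [LieAlgebra ℂ g] [FiniteDimensional ℂ g]
    (p : g →ₗ[ℂ] g →ₗ[ℂ] g) (hp : IsCommPostLieStruct p) (x y : g) :
    p x y ∈ LieAlgebra.radical ℂ g := by
  apply LieAlgebra.killingCompl_top_le_radical
  rw [LieIdeal.mem_killingCompl]
  intro z _
  rw [LieModule.traceForm_comm]
  have sk : ∀ x y z, killingForm ℂ g (p x y) z = - killingForm ℂ g (p x z) y := by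
    intro x y z
    rw [CPA.killing_skew (p x) (hp.ax3 x), LieModule.traceForm_comm]
  have h1 := sk x y z
  have h2 := sk z x y
  have h3 := sk y z x
  rw [hp.comm z x] at h2
  rw [hp.comm z y] at h2
  rw [hp.comm y x] at h3
  have : killingForm ℂ g (p x y) z = - killingForm ℂ g (p x y) z := by
    rw [← h3, ← neg_eq_iff_eq_neg.mpr h2, ← h1]
  exact self_eq_neg.mp this

/-- Schur-type lemma. -/
lemma CPA.schur {V σ ι : Type*} [AddCommGroup V] [Module ℂ V] [FiniteDimensional ℂ V]
    [DecidableEq ι] (A : σ → V →ₗ[ℂ] V) (W : ι → Submodule ℂ V)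
    (hint : DirectSum.IsInternal W) (hinv : ∀ i x, ∀ w ∈ W i, A x w ∈ W i)
    (hirr : ∀ i, W i ≠ ⊥ ∧ ∀ U : Submodule ℂ V, U ≤ W i →
      (∀ x, ∀ w ∈ U, A x w ∈ U) → U = ⊥ ∨ U = W i)
    (hnon : ∀ i j, i ≠ j → ¬ ∃ f : W i ≃ₗ[ℂ] W j,
      ∀ x, ∀ (w : W i) (hw : A x w ∈ W i), (f ⟨A x w, hw⟩ : V) = A x (f w : V))
    (T : V →ₗ[ℂ] V) (hT : ∀ x v, T (A x v) = A x (T v)) (i : ι) :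
    ∃ c : ℂ, ∀ w ∈ W i, T w = c • w := by
  classical
  let e := LinearEquiv.ofBijective (DirectSum.coeLinearMap W) hint
  let Q : (j : ι) → V →ₗ[ℂ] W j := fun j => DirectSum.component ℂ ι _ j ∘ₗ e.symm.toLinearMap
  have heQ : ∀ v, (∀ j, j ≠ i → Q j v = 0) → v ∈ W i := by
    intro v hv
    have : e.symm v = DirectSum.lof ℂ ι (fun i => W i) i (e.symm v i) := by
      refine DFinsupp.ext fun j => ?_
      by_cases h : j = i
      · subst h
        exact (DirectSum.lof_apply (M := fun i => W i) ℂ j _).symm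
      · have h0 : e.symm v j = 0 := hv j h
        rw [h0]
        exact (DirectSum.of_eq_of_ne (β := fun i => W i) i j _ h).symm
    have h2 : v = e (e.symm v) := (e.apply_symm_apply v).symm
    rw [h2, this]
    change DirectSum.coeLinearMap W _ ∈ _
    rw [DirectSum.coeLinearMap_lof]
    exact SetLike.coe_mem _
  have hes : ∀ k (w : W k), e.symm w = DirectSum.lof ℂ ι (fun i => W i) k w := by
    intro k w
    rw [LinearEquiv.symm_apply_eq]
    exact (DirectSum.coeLinearMap_lof W k w).symm
  have hQs : ∀ k (w : W k), Q k w = w := by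
    intro k w
    change (e.symm w) k = w
    rw [hes]; exact DirectSum.lof_apply (M := fun i => W i) ℂ k w
  have hQn : ∀ j k (w : W k), j ≠ k → Q j w = 0 := by
    intro j k w h
    change (e.symm w) j = 0
    rw [hes]; exact DirectSum.of_eq_of_ne (β := fun i => W i) k j _ h
  have hQA : ∀ j x v, (Q j (A x v) : V) = A x (Q j v) := by
    intro j x v
    have hv : v ∈ ⨆ k, W k := by rw [hint.submodule_iSup_eq_top]; trivial
    induction hv using Submodule.iSup_induction' with
    | mem k w hw =>
      by_cases h : j = k
      · subst h
        rw [show (Q j w : V) = w from congrArg Subtype.val (hQs j ⟨w, hw⟩)]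
        exact congrArg Subtype.val (hQs j ⟨A x w, hinv j x w hw⟩)
      · rw [show (Q j w) = 0 from (hQn j k ⟨w, hw⟩ h),
          show (Q j (A x w)) = 0 from (hQn j k ⟨A x w, hinv k x w hw⟩ h)]
        simp
    | zero => simp
    | add u v _ _ hu hv => simp [hu, hv]
  have hTW : ∀ w ∈ W i, T w ∈ W i := by
    intro w hw
    apply heQ
    intro j hj
    let F : W i →ₗ[ℂ] W j := Q j ∘ₗ T ∘ₗ (W i).subtype
    have hF : ∀ x (w : W i) (hw : A x w ∈ W i), (F ⟨A x w, hw⟩ : V) = A x (F w : V) := by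
      intro x w hw
      change (Q j (T (A x w)) : V) = A x (Q j (T w))
      rw [hT, hQA]
    suffices F = 0 from LinearMap.congr_fun this ⟨w, hw⟩
    rcases (hirr i).2 (F.ker.map (W i).subtype) (Submodule.map_subtype_le _ _) (by
      rintro x _ ⟨w, hw, rfl⟩
      refine ⟨⟨A x w, hinv i x _ w.2⟩, ?_, rfl⟩
      have hw : F w = 0 := hw
      change F _ = 0
      apply Subtype.ext
      rw [hF, hw]; simp) with h | h
    · have hk : F.ker = ⊥ := by
        exact Submodule.map_injective_of_injective (W i).injective_subtype (h.trans (Submodule.map_bot _).symm)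
      rcases (hirr j).2 (F.range.map (W j).subtype) (Submodule.map_subtype_le _ _) (by
        rintro x _ ⟨_, ⟨w, rfl⟩, rfl⟩
        exact ⟨_, ⟨⟨A x w, hinv i x _ w.2⟩, rfl⟩, hF x w _⟩) with h' | h'
      · replace h' := Submodule.map_injective_of_injective (W j).injective_subtype (h'.trans (Submodule.map_bot _).symm)
        exact LinearMap.range_eq_bot.mp h'
      · exfalso
        have hs : Function.Surjective F := by
          intro y
          have : (y : V) ∈ F.range.map (W j).subtype := h'.symm.le y.2
          obtain ⟨z, ⟨u, hu⟩, hz⟩ := this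
          exact ⟨u, hu.trans (Subtype.ext hz)⟩
        exact hnon i j (Ne.symm hj)
          ⟨LinearEquiv.ofBijective F ⟨LinearMap.ker_eq_bot.mp hk, hs⟩, fun x w hw => hF x w hw⟩
    · ext u
      have : (u : V) ∈ F.ker.map (W i).subtype := h.symm.le u.2
      obtain ⟨z, hz, hzu⟩ := this
      have : z = u := Subtype.ext hzu
      subst this
      have hz : F z = 0 := hz
      simp [hz]
  have : Nontrivial (W i) := Submodule.nontrivial_iff_ne_bot.mpr (hirr i).1
  obtain ⟨c, hc⟩ := Module.End.exists_eigenvalue (T.restrict hTW)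
  obtain ⟨v, hv⟩ := hc.exists_hasEigenvector
  have hv1 : T v = c • (v : V) := congrArg Subtype.val hv.apply_eq_smul
  refine ⟨c, ?_⟩
  rcases (hirr i).2 (W i ⊓ Module.End.eigenspace T c) inf_le_left (by
    rintro x w ⟨hw, hw'⟩
    refine ⟨hinv i x w hw, ?_⟩
    have hw' := Module.End.mem_eigenspace_iff.mp hw'
    exact Module.End.mem_eigenspace_iff.mpr (by rw [hT, hw', map_smul])) with h | h
  · exfalso
    apply hv.2
    apply Subtype.ext
    have : (v : V) ∈ W i ⊓ Module.End.eigenspace T c :=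
      ⟨v.2, Module.End.mem_eigenspace_iff.mpr hv1⟩
    rw [h] at this
    exact this
  · intro w hw
    rw [← h] at hw
    exact Module.End.mem_eigenspace_iff.mp hw.2

/-- Let `g = a ⋊ s` be a perfect Lie algebra whose abelian radical `a` decomposes, as an
`s`-module, into pairwise nonisomorphic irreducible `s`-modules.  Then any commutative
post-Lie algebra structure on `g` is trivial. -/
theorem statement17 (g : Type*) [LieRing g] [LieAlgebra ℂ g] [FiniteDimensional ℂ g]
    (hperf : ⁅(⊤ : LieIdeal ℂ g), (⊤ : LieIdeal ℂ g)⁆ = (⊤ : LieIdeal ℂ g))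
    (a : LieIdeal ℂ g) (ha : a = LieAlgebra.radical ℂ g)
    (habel : ∀ x ∈ a, ∀ y ∈ a, ⁅x, y⁆ = (0 : g))
    (s : LieSubalgebra ℂ g) [LieAlgebra.IsSemisimple ℂ s]
    (hcompl : IsCompl a.toSubmodule s.toSubmodule)
    (ι : Type) [Fintype ι] [DecidableEq ι] (W : ι → Submodule ℂ a)
    -- `a` is the internal direct sum of the submodules `W i`
    (hinternal : DirectSum.IsInternal W)
    -- each `W i` is `s`-invariant
    (hinv : ∀ i, ∀ x ∈ s, ∀ w ∈ W i, a.bracketAction x w ∈ W i)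
    -- each `W i` is a nonzero irreducible `s`-module
    (hirr : ∀ i, W i ≠ ⊥ ∧ ∀ U : Submodule ℂ a, U ≤ W i →
      (∀ x ∈ s, ∀ w ∈ U, a.bracketAction x w ∈ U) → U = ⊥ ∨ U = W i)
    -- the `W i` are pairwise nonisomorphic as `s`-modules
    (hnoniso : ∀ i j, i ≠ j → ¬ ∃ f : W i ≃ₗ[ℂ] W j,
      ∀ x ∈ s, ∀ (w : W i) (hw : a.bracketAction x (w : a) ∈ W i),
        (f ⟨a.bracketAction x (w : a), hw⟩ : a) = a.bracketAction x ((f w : W j) : a))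
    (p : g →ₗ[ℂ] g →ₗ[ℂ] g) (hp : IsCommPostLieStruct p) :
    ∀ x y : g, p x y = 0 := by
  have hpa : ∀ x y, p x y ∈ a := fun x y => ha ▸ CPA.mem_radical p hp x y
  -- a perfect Lie algebra is spanned by brackets
  have hspan : ∀ N : Submodule ℂ g, (∀ x y : g, ⁅x, y⁆ ∈ N) → ∀ x, x ∈ N := by
    intro N hN x
    have hx : x ∈ ⁅(⊤ : LieIdeal ℂ g), (⊤ : LieIdeal ℂ g)⁆ := by rw [hperf]; trivial
    rw [← LieSubmodule.mem_toSubmodule, LieSubmodule.lieIdeal_oper_eq_linear_span'] at hx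
    refine Submodule.span_le.mpr ?_ hx
    rintro _ ⟨u, -, v, -, rfl⟩
    exact hN u v
  let A : s → a →ₗ[ℂ] a := fun x =>
    { toFun := fun w => a.bracketAction x w
      map_add' := fun u v => Subtype.ext (by simp [LieIdeal.bracketAction])
      map_smul' := fun c v => Subtype.ext (by simp [LieIdeal.bracketAction]) }
  let T : g → a →ₗ[ℂ] a := fun x => ((p x) ∘ₗ a.toSubmodule.subtype).codRestrict a.toSubmodule
    (fun w => hpa x w)
  have hTv : ∀ x (w : a), (T x w : g) = p x w := fun x w => rfl
  have hsch : ∀ x i, ∃ c : ℂ, ∀ w ∈ W i, T x w = c • w := by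
    intro x i
    refine CPA.schur A W hinternal (fun i y w hw => hinv i y y.2 w hw)
      (fun i => ⟨(hirr i).1, fun U hU h => (hirr i).2 U hU fun y hy w hw => h ⟨y, hy⟩ w hw⟩)
      (fun i j hij ⟨f, hf⟩ => hnoniso i j hij ⟨f, fun y hy w hw => hf ⟨y, hy⟩ w hw⟩)
      (T x) ?_ i
    intro y w
    apply Subtype.ext
    change p x ⁅(y : g), (w : g)⁆ = ⁅(y : g), p x w⁆
    rw [hp.ax3, habel _ (hpa x y) _ w.2, zero_add]
  have hcomm : ∀ x y (w : a), T x (T y w) = T y (T x w) := by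
    intro x y w
    have hw : w ∈ ⨆ k, W k := by rw [hinternal.submodule_iSup_eq_top]; trivial
    induction hw using Submodule.iSup_induction' with
    | mem k w hw =>
      obtain ⟨c, hc⟩ := hsch x k
      obtain ⟨d, hd⟩ := hsch y k
      rw [hd w hw, hc w hw, map_smul, map_smul, hd w hw, hc w hw, smul_comm]
    | zero => simp
    | add u v _ _ hu hv => simp only [map_add, hu, hv]
  have hga : ∀ x, ∀ b ∈ a, p x b = 0 := by
    intro x b hb
    refine hspan (LinearMap.ker (p.flip b)) (fun u v => ?_) x
    change p ⁅u, v⁆ b = 0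
    rw [hp.ax2, sub_eq_zero]
    exact congrArg Subtype.val (hcomm u v ⟨b, hb⟩)
  intro x y
  refine hspan (LinearMap.ker (p.flip y)) (fun u v => ?_) x
  change p ⁅u, v⁆ y = 0
  rw [hp.ax2, hga _ _ (hpa _ _), hga _ _ (hpa _ _), sub_zero]
end

section
/- Let g be a finite-dimensional perfect complex Lie algebra whose solvable radical is abelian, and suppose that every derivation of g is inner. Then any commutative post-Lie algebra structure on g is trivial. -/
/-- On a perfect Lie algebra, a linear map which kills all brackets is zero. -/
theorem eq_zero_of_perfect_of_lie {g V : Type*} [LieRing g] [LieAlgebra ℂ g]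
    [AddCommGroup V] [Module ℂ V]
    (hperf : ⁅(⊤ : LieIdeal ℂ g), (⊤ : LieIdeal ℂ g)⁆ = (⊤ : LieIdeal ℂ g))
    (f : g →ₗ[ℂ] V) (hf : ∀ x y : g, f ⁅x, y⁆ = 0) (x : g) : f x = 0 := by
  have hx : x ∈ (⁅(⊤ : LieIdeal ℂ g), (⊤ : LieIdeal ℂ g)⁆ : LieIdeal ℂ g).toSubmodule := by
    rw [hperf]; exact LieSubmodule.mem_top x
  rw [LieSubmodule.lieIdeal_oper_eq_linear_span'] at hx
  have hle : Submodule.span ℂ {m : g | ∃ x ∈ (⊤ : LieIdeal ℂ g), ∃ n ∈ (⊤ : LieIdeal ℂ g),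
      ⁅x, n⁆ = m} ≤ LinearMap.ker f := by
    rw [Submodule.span_le]
    rintro m ⟨u, -, v, -, rfl⟩
    exact hf u v
  exact hle hx

/-- Let `g` be a perfect complex Lie algebra whose solvable radical is abelian and all of
whose derivations are inner.  Then any commutative post-Lie algebra structure on `g` is
trivial. -/
theorem statement18 (g : Type*) [LieRing g] [LieAlgebra ℂ g] [FiniteDimensional ℂ g]
    (hperf : ⁅(⊤ : LieIdeal ℂ g), (⊤ : LieIdeal ℂ g)⁆ = (⊤ : LieIdeal ℂ g))
    (habel : IsLieAbelian (LieAlgebra.radical ℂ g))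
    (hinner : ∀ D : g →ₗ[ℂ] g, (∀ u v : g, D ⁅u, v⁆ = ⁅D u, v⁆ + ⁅u, D v⁆) →
      ∃ z : g, ∀ u : g, D u = ⁅z, u⁆)
    (p : g →ₗ[ℂ] g →ₗ[ℂ] g) (hp : IsCommPostLieStruct p) :
    ∀ x y : g, p x y = 0 := by
  have hin : ∀ x : g, ∃ z : g, ∀ u : g, p x u = ⁅z, u⁆ := fun x => hinner (p x) (hp.ax3 x)
  have hskew : ∀ x y z : g, killingForm ℂ g (p x y) z = - killingForm ℂ g (p x z) y := by
    intro x y z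
    obtain ⟨w, hw⟩ := hin x
    rw [hw, hw, LieModule.traceForm_apply_lie_apply', LieModule.traceForm_comm]
  have hT : ∀ x y z : g, killingForm ℂ g (p x y) z = 0 := by
    intro x y z
    have h1 := hskew x y z
    have h2 := hskew y z x
    have h3 := hskew z x y
    rw [hp.comm y x] at h2
    rw [hp.comm z x, hp.comm z y] at h3
    rw [h1] at h2
    rw [h3] at h2 h1
    rw [h2] at h1 h3
    grind
  have hrad : ∀ z : g, (∀ u : g, killingForm ℂ g z u = 0) → z ∈ LieAlgebra.radical ℂ g := by
    intro z hz
    apply LieAlgebra.killingCompl_top_le_radical ℂ g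
    rw [LieIdeal.mem_killingCompl]
    intro y _
    rw [LieModule.traceForm_comm]
    exact hz y
  have hLL : ∀ x y u : g, p x (p y u) = 0 := by
    intro x y u
    obtain ⟨z, hz⟩ := hin x
    have hzr : z ∈ LieAlgebra.radical ℂ g := by
      refine hrad z (eq_zero_of_perfect_of_lie hperf _ fun a b => ?_)
      rw [← LieModule.traceForm_apply_lie_apply, ← hz]
      exact hT x a b
    have hyr : p y u ∈ LieAlgebra.radical ℂ g := hrad _ (hT y u)
    rw [hz]
    have := habel.trivial ⟨z, hzr⟩ ⟨p y u, hyr⟩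
    exact congrArg Subtype.val this
  intro x y
  have : p x = 0 := by
    refine eq_zero_of_perfect_of_lie hperf p (fun a b => ?_) x
    ext u
    rw [hp.ax2, hLL, hLL]; simp
  rw [this]; rfl
end
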